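/- arXiv:2209.01451 — 2 statements merged into one kernel-verified Lean document; each statement's English description precedes it below -/
import Mathlib

section
/- Let F : ℝⁿ → ℝⁿ be a polynomial mapping. Then F is an open mapping if and only if all fibers F⁻¹(a) (a ∈ ℝⁿ) are finite and the sign of det JF does not change, i.e. det JF(x) ≥ 0 for all x ∈ ℝⁿ or det JF(x) ≤ 0 for all x ∈ ℝⁿ. -/
open MvPolynomial

namespace MvPolynomial

theorem hasStrictFDerivAt_eval {n : ℕ} (p : MvPolynomial (Fin n) ℝ) (x : Fin n → ℝ) :
    HasStrictFDerivAt (fun x : Fin n → ℝ => eval x p)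
      (∑ j, eval x (pderiv j p) • ContinuousLinearMap.proj (R := ℝ) (φ := fun _ : Fin n => ℝ) j)
      x := by
  induction p using MvPolynomial.induction_on with
  | C a => simpa using hasStrictFDerivAt_const a x
  | add p q hp hq =>
    simp only [map_add, add_smul, Finset.sum_add_distrib]
    exact hp.add hq
  | mul_X p i hp =>
    have hX : HasStrictFDerivAt (fun x : Fin n → ℝ => eval x (X i : MvPolynomial (Fin n) ℝ))
        (ContinuousLinearMap.proj (R := ℝ) (φ := fun _ : Fin n => ℝ) i) x := by
      simp only [eval_X]
      exact (ContinuousLinearMap.proj (R := ℝ) (φ := fun _ : Fin n => ℝ) i).hasStrictFDerivAt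
    have h := hp.mul hX
    simp only [map_mul]
    refine h.congr_fderiv ?_
    ext v
    simp [pderiv_X, Pi.single_apply, add_mul, Finset.sum_add_distrib, Finset.mul_sum, apply_ite,
      mul_assoc]

theorem contDiff_eval {n : ℕ} (p : MvPolynomial (Fin n) ℝ) {m : WithTop ℕ∞} :
    ContDiff ℝ m (fun x : Fin n → ℝ => eval x p) := by
  induction p using MvPolynomial.induction_on with
  | C a => simpa using contDiff_const
  | add p q hp hq => simpa using hp.add hq
  | mul_X p i hp => simpa using hp.mul (contDiff_apply ℝ ℝ i)

theorem pderiv_pderiv_comm {σ R : Type*} [CommRing R] (i j : σ) (p : MvPolynomial σ R) :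
    pderiv i (pderiv j p) = pderiv j (pderiv i p) := by
  classical
  have h : ⁅pderiv (R := R) i, pderiv (R := R) j⁆ = 0 := by
    refine derivation_ext fun k => ?_
    rw [Derivation.commutator_apply]
    simp [pderiv_X, Pi.single_apply, apply_ite]
  have h2 := DFunLike.congr_fun h p
  rw [Derivation.commutator_apply] at h2
  exact sub_eq_zero.1 h2

end MvPolynomial

theorem Derivation.map_prod_eq_sum {R A ι : Type*} [CommRing R] [CommRing A] [Algebra R A]
    [DecidableEq ι] (D : Derivation R A A) (s : Finset ι) (f : ι → A) :
    D (∏ i ∈ s, f i) = ∑ l ∈ s, ∏ i ∈ s, (if i = l then D (f i) else f i) := by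
  induction s using Finset.induction_on with
  | empty => simp
  | insert a s ha ih =>
    rw [Finset.prod_insert ha, D.leibniz, ih, Finset.sum_insert ha, Finset.prod_insert ha]
    simp only [smul_eq_mul, if_true]
    rw [add_comm, mul_comm]
    congr 1
    · congr 1
      refine Finset.prod_congr rfl fun i hi => ?_
      rw [if_neg (by rintro rfl; exact ha hi)]
    · rw [Finset.mul_sum]
      refine Finset.sum_congr rfl fun l hl => ?_
      rw [Finset.prod_insert ha, if_neg (by rintro rfl; exact ha hl)]

theorem Derivation.map_det {R A ι : Type*} [CommRing R] [CommRing A] [Algebra R A]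
    [DecidableEq ι] [Fintype ι] (D : Derivation R A A) (M : Matrix ι ι A) :
    D M.det = ∑ l, (M.updateRow l fun j => D (M l j)).det := by
  rw [← Matrix.det_transpose, Matrix.det_apply, map_sum]
  simp_rw [← Matrix.det_transpose (Matrix.updateRow _ _ _), Matrix.det_apply]
  rw [Finset.sum_comm]
  refine Finset.sum_congr rfl fun τ _ => ?_
  rw [← Finset.smul_sum, Units.smul_def, Units.smul_def, map_zsmul, D.map_prod_eq_sum]
  congr 1
  refine Finset.sum_congr rfl fun l _ => Finset.prod_congr rfl fun i _ => ?_
  by_cases h : i = l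
  · subst h; simp
  · simp [h, Matrix.updateRow_ne]

/-- The Piola identity: the columns of the adjugate of a Jacobian matrix are divergence free. -/
theorem MvPolynomial.sum_pderiv_adjugate_jacobian {σ : Type*} [Fintype σ] [DecidableEq σ]
    (P : σ → MvPolynomial σ ℝ) (k : σ) :
    ∑ i, pderiv i ((Matrix.of fun i j => pderiv j (P i)).adjugate i k) = 0 := by
  set J : Matrix σ σ (MvPolynomial σ ℝ) := Matrix.of fun i j => pderiv j (P i) with hJ
  simp_rw [Matrix.adjugate_apply, Derivation.map_det]
  rw [Finset.sum_comm]
  refine Finset.sum_eq_zero fun l _ => ?_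
  by_cases hlk : l = k
  · subst hlk
    refine Finset.sum_eq_zero fun i _ => Matrix.det_eq_zero_of_row_eq_zero l fun j => ?_
    simp [Pi.single_apply, apply_ite]
  set T : σ → σ → MvPolynomial σ ℝ := fun i j =>
    ((J.updateRow k (Pi.single i 1)).updateRow l (Pi.single j 1)).det with hT
  have hanti : ∀ i j, T j i = - T i j := by
    intro i j
    have : ((J.updateRow k (Pi.single j 1)).updateRow l (Pi.single i 1)) =
        ((J.updateRow k (Pi.single i 1)).updateRow l (Pi.single j 1)).submatrix
          (Equiv.swap l k) id := by
      ext a b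
      rcases eq_or_ne a l with rfl | hal
      · simp [Matrix.updateRow_apply, Ne.symm hlk]
      · rcases eq_or_ne a k with rfl | hak
        · simp [Matrix.updateRow_apply, hal]
        · simp [Matrix.updateRow_apply, hal, hak, Equiv.swap_apply_of_ne_of_ne hal hak]
    simp only [hT]
    rw [this, Matrix.det_permute]
    simp [Equiv.Perm.sign_swap hlk]
  have hexp : ∀ i, ((J.updateRow k (Pi.single i 1)).updateRow l
      fun j => pderiv i ((J.updateRow k (Pi.single i 1)) l j)).det =
      ∑ j, pderiv i (pderiv j (P l)) * T i j := by
    intro i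
    have : (fun j => pderiv i ((J.updateRow k (Pi.single i 1)) l j)) =
        ∑ j, pderiv i (pderiv j (P l)) • (Pi.single j 1 : σ → MvPolynomial σ ℝ) := by
      ext1 j
      simp [Matrix.updateRow_apply, hlk, hJ, Pi.single_apply]
    rw [this]
    refine (Matrix.detRowAlternating.toMultilinearMap.map_update_sum Finset.univ l _ _).trans ?_
    exact Finset.sum_congr rfl fun j _ => Matrix.det_updateRow_smul _ _ _ _
  simp_rw [hexp]
  have hsym : ∑ i, ∑ j, pderiv i (pderiv j (P l)) * T i j =
      - ∑ i, ∑ j, pderiv i (pderiv j (P l)) * T i j := by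
    conv_lhs => rw [Finset.sum_comm]
    rw [← Finset.sum_neg_distrib]
    refine Finset.sum_congr rfl fun i _ => ?_
    rw [← Finset.sum_neg_distrib]
    refine Finset.sum_congr rfl fun j _ => ?_
    rw [hanti i j, pderiv_pderiv_comm]
    ring
  exact self_eq_neg.1 hsym

section

open MeasureTheory

namespace MvPolynomial

/-- The Jacobian matrix of a tuple of polynomials. -/
noncomputable def jacobian {n : ℕ} (P : Fin n → MvPolynomial (Fin n) ℝ) :
    Matrix (Fin n) (Fin n) (MvPolynomial (Fin n) ℝ) :=
  Matrix.of fun i j => pderiv j (P i)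

/-- The map `ℝⁿ → ℝⁿ` given by a tuple of polynomials. -/
noncomputable def evalMap {n : ℕ} (P : Fin n → MvPolynomial (Fin n) ℝ) (x : Fin n → ℝ) :
    Fin n → ℝ :=
  fun i => eval x (P i)

variable {n : ℕ} (P : Fin n → MvPolynomial (Fin n) ℝ)

theorem eval_det_jacobian (x : Fin n → ℝ) :
    eval x (jacobian P).det = ((jacobian P).map (eval x)).det := by
  rw [RingHom.map_det]; rfl

theorem hasStrictFDerivAt_evalMap (x : Fin n → ℝ) :
    HasStrictFDerivAt (evalMap P)
      (LinearMap.toContinuousLinearMap (Matrix.toLin' ((jacobian P).map (eval x)))) x := by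
  refine hasStrictFDerivAt_pi'.2 fun i => ?_
  refine (hasStrictFDerivAt_eval (P i) x).congr_fderiv ?_
  ext v
  simp [jacobian, Matrix.mulVec, dotProduct]

theorem contDiff_evalMap {m : WithTop ℕ∞} : ContDiff ℝ m (evalMap P) :=
  contDiff_pi.2 fun i => contDiff_eval (P i)

theorem det_mul_fderiv_eq_sum {φ : (Fin n → ℝ) → ℝ} (hφ : Differentiable ℝ φ)
    (v x : Fin n → ℝ) :
    eval x (jacobian P).det * fderiv ℝ φ (evalMap P x) v =
      ∑ i, eval x (∑ k, (jacobian P).adjugate i k * C (v k)) *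
        fderiv ℝ (φ ∘ evalMap P) x (Pi.single i 1) := by
  rw [fderiv_comp x (hφ _) (hasStrictFDerivAt_evalMap P x).hasFDerivAt.differentiableAt,
    (hasStrictFDerivAt_evalMap P x).hasFDerivAt.fderiv]
  have hv : eval x (jacobian P).det • v =
      ∑ i, eval x (∑ k, (jacobian P).adjugate i k * C (v k)) •
        (Matrix.toLin' ((jacobian P).map (eval x))) (Pi.single i 1) := by
    have h1 : (fun i => eval x (∑ k, (jacobian P).adjugate i k * C (v k))) =
        ((jacobian P).map (eval x)).adjugate.mulVec v := by
      ext i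
      have h2 : ((jacobian P).map (eval x)).adjugate = (jacobian P).adjugate.map (eval x) :=
        ((eval x).map_adjugate (jacobian P)).symm
      simp [h2, Matrix.mulVec, dotProduct]
    have h3 : ∀ w : Fin n → ℝ, ∑ i, w i •
        (Matrix.toLin' ((jacobian P).map (eval x))) (Pi.single i 1) =
        (Matrix.toLin' ((jacobian P).map (eval x))) w := by
      intro w
      simp_rw [← map_smul]
      rw [← map_sum]
      congr 1
      ext j
      simp [Pi.single_apply]
    rw [h3 (fun i => eval x (∑ k, (jacobian P).adjugate i k * C (v k))), h1, Matrix.toLin'_apply,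
      Matrix.mulVec_mulVec, Matrix.mul_adjugate, Matrix.smul_mulVec, Matrix.one_mulVec,
      eval_det_jacobian]
  rw [← smul_eq_mul, ← map_smul, hv, map_sum]
  refine Finset.sum_congr rfl fun i _ => ?_
  rw [map_smul]
  rfl

theorem integral_cutoff_mul_fderiv_mul_det_eq_zero {η φ : (Fin n → ℝ) → ℝ}
    (hη : ContDiff ℝ 1 η) (hηc : HasCompactSupport η) (hφ : ContDiff ℝ 1 φ)
    (h : ∀ x, fderiv ℝ η x ≠ 0 → φ (evalMap P x) = 0) (v : Fin n → ℝ) :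
    ∫ x, η x * (eval x (jacobian P).det * fderiv ℝ φ (evalMap P x) v) = 0 := by
  set A : Fin n → MvPolynomial (Fin n) ℝ :=
    fun i => ∑ k, (jacobian P).adjugate i k * C (v k) with hA
  have hdivA : ∑ i, pderiv i (A i) = 0 := by
    simp only [hA, map_sum]
    rw [Finset.sum_comm]
    refine Finset.sum_eq_zero fun k _ => ?_
    have := sum_pderiv_adjugate_jacobian P k
    simp only [Derivation.leibniz, pderiv_C, smul_eq_mul, mul_zero, zero_add]
    rw [← Finset.mul_sum]
    exact mul_eq_zero_of_right _ this
  have hφF : ContDiff ℝ 1 (φ ∘ evalMap P) := hφ.comp (contDiff_evalMap P)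
  have hcont : ∀ i, Continuous fun x => fderiv ℝ (φ ∘ evalMap P) x (Pi.single i 1) := fun i =>
    (hφF.continuous_fderiv one_ne_zero).clm_apply continuous_const
  have hηA : ∀ i, ContDiff ℝ 1 fun x => η x * eval x (A i) := fun i => hη.mul (contDiff_eval _)
  have hηAc : ∀ i, HasCompactSupport fun x => η x * eval x (A i) := fun i => hηc.mul_right
  have hηAd : ∀ i, Continuous fun x =>
      fderiv ℝ (fun x => η x * eval x (A i)) x (Pi.single i 1) := fun i =>
    ((hηA i).continuous_fderiv one_ne_zero).clm_apply continuous_const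
  have hηAdc : ∀ i, HasCompactSupport fun x =>
      fderiv ℝ (fun x => η x * eval x (A i)) x (Pi.single i 1) := fun i =>
    (hηAc i).fderiv_apply ℝ _
  have hI : ∀ i, Integrable fun x =>
      (η x * eval x (A i)) * fderiv ℝ (φ ∘ evalMap P) x (Pi.single i 1) := fun i =>
    ((hηA i).continuous.mul (hcont i)).integrable_of_hasCompactSupport (hηAc i).mul_right
  have hI' : ∀ i, Integrable fun x =>
      fderiv ℝ (fun x => η x * eval x (A i)) x (Pi.single i 1) * (φ ∘ evalMap P) x := fun i =>
    ((hηAd i).mul hφF.continuous).integrable_of_hasCompactSupport (hηAdc i).mul_right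
  have hI'' : ∀ i, Integrable fun x => (η x * eval x (A i)) * (φ ∘ evalMap P) x := fun i =>
    ((hηA i).continuous.mul hφF.continuous).integrable_of_hasCompactSupport (hηAc i).mul_right
  calc ∫ x, η x * (eval x (jacobian P).det * fderiv ℝ φ (evalMap P x) v)
      = ∫ x, ∑ i, (η x * eval x (A i)) * fderiv ℝ (φ ∘ evalMap P) x (Pi.single i 1) := by
        refine integral_congr_ae (.of_forall fun x => ?_)
        dsimp only
        rw [det_mul_fderiv_eq_sum P (hφ.differentiable one_ne_zero), Finset.mul_sum]
        simp only [hA, mul_assoc]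
    _ = ∑ i, ∫ x, (η x * eval x (A i)) * fderiv ℝ (φ ∘ evalMap P) x (Pi.single i 1) :=
        integral_finsetSum _ fun i _ => hI i
    _ = ∑ i, -∫ x, fderiv ℝ (fun x => η x * eval x (A i)) x (Pi.single i 1) *
          (φ ∘ evalMap P) x := by
        refine Finset.sum_congr rfl fun i _ => ?_
        exact integral_mul_fderiv_eq_neg_fderiv_mul_of_integrable (hI' i) (hI i) (hI'' i)
          (fun x _ => (hηA i).differentiable one_ne_zero x)
          (fun x _ => hφF.differentiable one_ne_zero x)
    _ = -∫ x, ∑ i, fderiv ℝ (fun x => η x * eval x (A i)) x (Pi.single i 1) *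
          (φ ∘ evalMap P) x := by
        rw [Finset.sum_neg_distrib, integral_finsetSum _ fun i _ => hI' i]
    _ = -∫ x, (0 : ℝ) := by
        congr 1
        refine integral_congr_ae (.of_forall fun x => ?_)
        dsimp only [Function.comp_apply]
        rw [← Finset.sum_mul]
        by_cases hx : fderiv ℝ η x = 0
        · refine mul_eq_zero_of_left ?_ _
          have hd : ∀ i, fderiv ℝ (fun x => η x * eval x (A i)) x (Pi.single i 1) =
              η x * eval x (pderiv i (A i)) := by
            intro i
            have h1 := ((hη.differentiable one_ne_zero) x).hasFDerivAt.mul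
              (hasStrictFDerivAt_eval (A i) x).hasFDerivAt
            rw [hx] at h1
            have h2 := h1.fderiv
            simp only [Pi.mul_def] at h2
            rw [h2]
            simp [Pi.single_apply]
          simp_rw [hd]
          rw [← Finset.mul_sum, ← map_sum, hdivA, map_zero, mul_zero]
        · rw [h x hx, mul_zero]
    _ = 0 := by simp

theorem integral_cutoff_mul_comp_sub_mul_det_eq {η φ : (Fin n → ℝ) → ℝ}
    (hη : ContDiff ℝ 1 η) (hηc : HasCompactSupport η) (hφ : ContDiff ℝ 1 φ)
    (hφc : HasCompactSupport φ) {S : Set (Fin n → ℝ)} (hS : Convex ℝ S)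
    (h : ∀ y ∈ S, ∀ x, fderiv ℝ η x ≠ 0 → φ (evalMap P x - y) = 0) {y₀ y₁ : Fin n → ℝ}
    (hy₀ : y₀ ∈ S) (hy₁ : y₁ ∈ S) :
    ∫ x, η x * (eval x (jacobian P).det * φ (evalMap P x - y₁)) =
      ∫ x, η x * (eval x (jacobian P).det * φ (evalMap P x - y₀)) := by
  set v := y₁ - y₀ with hv
  set D : (Fin n → ℝ) → ℝ := fun x => eval x (jacobian P).det with hD
  have hDc : Continuous D := (contDiff_eval (m := 0) _).continuous
  have hFc : Continuous (evalMap P) := (contDiff_evalMap P (m := 0)).continuous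
  have hdφ : Continuous (fderiv ℝ φ) := hφ.continuous_fderiv one_ne_zero
  obtain ⟨M, hM⟩ := hdφ.bounded_above_of_compact_support (hφc.fderiv ℝ)
  set g : ℝ → ℝ := fun t => ∫ x, η x * (D x * φ (evalMap P x - (y₀ + t • v))) with hg
  have hcontg : ∀ t : ℝ, Continuous fun x => η x * (D x * φ (evalMap P x - (y₀ + t • v))) :=
    fun t => hη.continuous.mul (hDc.mul (hφ.continuous.comp (hFc.sub continuous_const)))
  have hdiff : ∀ t ∈ Set.Icc (0 : ℝ) 1, HasDerivAt g 0 t := by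
    intro t ht
    have hmem : y₀ + t • v ∈ S := hS.add_smul_sub_mem hy₀ hy₁ ht
    have key := hasDerivAt_integral_of_dominated_loc_of_deriv_le (μ := volume) (x₀ := t)
      (F := fun t x => η x * (D x * φ (evalMap P x - (y₀ + t • v))))
      (F' := fun t x => η x * (D x * -(fderiv ℝ φ (evalMap P x - (y₀ + t • v)) v)))
      (bound := fun x => ‖η x * D x‖ * (M * ‖v‖)) (s := Set.univ) Filter.univ_mem
      (.of_forall fun t => (hcontg t).aestronglyMeasurable)
      ((hcontg t).integrable_of_hasCompactSupport hηc.mul_right)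
      (Continuous.aestronglyMeasurable (by fun_prop))
      (.of_forall fun x s _ => by
        rw [← mul_assoc, norm_mul, norm_neg]
        gcongr
        exact ((fderiv ℝ φ _).le_opNorm v).trans (by gcongr; exact hM _))
      (((hη.continuous.mul hDc).norm.mul continuous_const).integrable_of_hasCompactSupport
        (hηc.mul_right.norm.mul_right))
      (.of_forall fun x s _ => by
        have h1 : HasDerivAt (fun t : ℝ => evalMap P x - (y₀ + t • v)) (-v) s := by
          simpa using (((hasDerivAt_id s).smul_const v).const_add y₀).const_sub (evalMap P x)
        have h2 := ((hφ.differentiable one_ne_zero _).hasFDerivAt.comp_hasDerivAt s h1)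
        rw [map_neg] at h2
        exact (h2.const_mul (D x)).const_mul (η x))
    have hz := integral_cutoff_mul_fderiv_mul_det_eq_zero P (φ := fun z => φ (z - (y₀ + t • v)))
      hη hηc (hφ.comp (contDiff_id.sub contDiff_const)) (h _ hmem) v
    simp only [fderiv_comp_sub] at hz
    have h3 : ∫ x, η x * (D x * -(fderiv ℝ φ (evalMap P x - (y₀ + t • v)) v)) = 0 := by
      rw [← neg_zero, ← hz, ← integral_neg]
      simp only [hD, mul_neg]
    rw [← h3]
    exact key.2
  have := constant_of_has_deriv_right_zero (f := g) (a := 0) (b := 1)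
    (fun t ht => (hdiff t ht).continuousAt.continuousWithinAt)
    (fun t ht => (hdiff t ⟨ht.1, ht.2.le⟩).hasDerivWithinAt) 1 (by simp)
  simpa [hg, hv] using this

end MvPolynomial

end

section

open MeasureTheory Metric Filter Topology

namespace MvPolynomial

variable {n : ℕ} (P : Fin n → MvPolynomial (Fin n) ℝ)

theorem continuous_evalMap : Continuous (evalMap P) :=
  (contDiff_evalMap P (m := 0)).continuous

theorem continuous_eval_real {n : ℕ} (p : MvPolynomial (Fin n) ℝ) :
    Continuous fun x : Fin n → ℝ => eval x p :=
  (contDiff_eval (m := 0) p).continuous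

/-- Invariance of the local degree: if the values near that of `p` are attained with positive
Jacobian only, and `p` is a regular point, then all other nearby values can be approximated by
values at points with positive Jacobian. -/
theorem exists_det_jacobian_pos_of_dist_lt (σ : ℝ) {z : Fin n → ℝ} {r δ : ℝ} (hr : 0 < r)
    (hδ : ∀ x ∈ closedBall z r, r / 2 ≤ dist x z → δ ≤ dist (evalMap P x) (evalMap P z))
    {p : Fin n → ℝ} (hp : p ∈ ball z r) (hFp : evalMap P p ∈ ball (evalMap P z) (δ / 2))
    (hDp : 0 < σ * eval p (jacobian P).det) {ε₀ : ℝ} (hε₀ : 0 < ε₀)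
    (hD : ∀ x ∈ ball z r, dist (evalMap P x) (evalMap P p) < ε₀ →
      0 ≤ σ * eval x (jacobian P).det)
    {y : Fin n → ℝ} (hy : y ∈ ball (evalMap P z) (δ / 2)) {ε₁ : ℝ} (hε₁ : 0 < ε₁) :
    ∃ x ∈ ball z r, dist (evalMap P x) y < ε₁ ∧ 0 < σ * eval x (jacobian P).det := by
  by_contra! hcon
  have hδ0 : 0 < δ / 2 := dist_nonneg.trans_lt hy
  set ε := min (min ε₀ ε₁) (δ / 2) with hεdef
  have hε : 0 < ε := lt_min (lt_min hε₀ hε₁) hδ0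
  let η : ContDiffBump z := ⟨r / 2, r, by positivity, by linarith⟩
  let ρ : ContDiffBump (0 : Fin n → ℝ) := ⟨ε / 2, ε, by positivity, by linarith⟩
  have hη0 : ∀ x, x ∉ ball z r → η x = 0 := fun x hx => by
    refine η.zero_of_le_dist ?_
    simpa using hx
  have hρ0 : ∀ w, ε ≤ ‖w‖ → ρ w = 0 := fun w hw => by
    refine ρ.zero_of_le_dist ?_
    simpa using hw
  have key := integral_cutoff_mul_comp_sub_mul_det_eq P (η := η) (φ := ρ) η.contDiff
    η.hasCompactSupport ρ.contDiff ρ.hasCompactSupport (convex_ball (evalMap P z) (δ / 2))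
    (fun w hw x hx => by
      have h1 : r / 2 ≤ dist x z := by
        by_contra! hlt
        have : (η : (Fin n → ℝ) → ℝ) =ᶠ[𝓝 x] fun _ => 1 := η.eventuallyEq_one_of_mem_ball hlt
        exact hx (by rw [this.fderiv_eq]; simp)
      have h2 : dist x z ≤ r := by
        by_contra! hlt
        have : (η : (Fin n → ℝ) → ℝ) =ᶠ[𝓝 x] fun _ => 0 := by
          filter_upwards [(isOpen_lt continuous_const (continuous_id.dist continuous_const)).mem_nhds
            hlt] with x' hx'
          exact η.zero_of_le_dist (le_of_lt hx')
        exact hx (by rw [this.fderiv_eq]; simp)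
      have h3 := hδ x h2 h1
      refine hρ0 _ ?_
      rw [← dist_eq_norm]
      have h4 := dist_triangle (evalMap P x) w (evalMap P z)
      have h5 : dist w (evalMap P z) < δ / 2 := hw
      have h6 : ε ≤ δ / 2 := min_le_right _ _
      linarith) hFp hy
  have hDc := continuous_eval_real (jacobian P).det
  have hcont : ∀ w, Continuous fun x =>
      η x * (eval x (jacobian P).det * ρ (evalMap P x - w)) := fun w =>
    η.continuous.mul (hDc.mul (ρ.continuous.comp ((continuous_evalMap P).sub continuous_const)))
  have hle : σ * ∫ x, η x * (eval x (jacobian P).det * ρ (evalMap P x - y)) ≤ 0 := by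
    rw [← integral_const_mul]
    refine integral_nonpos fun x => ?_
    dsimp only [Pi.zero_apply]
    by_cases hx : x ∈ ball z r
    · by_cases hx' : dist (evalMap P x) y < ε₁
      · have h1 := hcon x hx hx'
        have h2 : 0 ≤ η x * ρ (evalMap P x - y) := mul_nonneg η.nonneg ρ.nonneg
        calc _ = (σ * eval x (jacobian P).det) * (η x * ρ (evalMap P x - y)) := by ring
          _ ≤ 0 := mul_nonpos_of_nonpos_of_nonneg h1 h2
      · rw [hρ0 (evalMap P x - y)]
        · simp
        · rw [← dist_eq_norm]
          exact ((min_le_left _ _).trans (min_le_right _ _)).trans (not_lt.1 hx')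
    · simp [hη0 x hx]
  have hpos : 0 < σ * ∫ x, η x * (eval x (jacobian P).det * ρ (evalMap P x - evalMap P p)) := by
    rw [← integral_const_mul]
    refine Continuous.integral_pos_of_hasCompactSupport_nonneg_nonzero (x := p)
      (continuous_const.mul (hcont _)) (η.hasCompactSupport.mul_right.mul_left) (fun x => ?_) ?_
    · dsimp only [Pi.zero_apply]
      have h2 : 0 ≤ η x * ρ (evalMap P x - evalMap P p) := mul_nonneg η.nonneg ρ.nonneg
      by_cases hx : x ∈ ball z r
      · by_cases hx' : dist (evalMap P x) (evalMap P p) < ε₀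
        · calc 0 ≤ (σ * eval x (jacobian P).det) * (η x * ρ (evalMap P x - evalMap P p)) :=
              mul_nonneg (hD x hx hx') h2
            _ = _ := by ring
        · rw [hρ0 (evalMap P x - evalMap P p)]
          · simp
          · rw [← dist_eq_norm]
            exact ((min_le_left _ _).trans (min_le_left _ _)).trans (not_lt.1 hx')
      · simp [hη0 x hx]
    · have h1 : 0 < η p := η.pos_of_mem_ball hp
      have h2 : ρ (evalMap P p - evalMap P p) = 1 :=
        ρ.one_of_mem_closedBall (by simpa [ρ] using (half_pos hε).le)
      rw [h2, mul_one, mul_left_comm]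
      exact (mul_pos h1 hDp).ne'
  rw [key] at hle
  exact absurd hpos (not_lt.2 hle)

theorem exists_pos_le_dist_of_isolated {f : (Fin n → ℝ) → (Fin n → ℝ)} (hf : Continuous f)
    {z : Fin n → ℝ} {r : ℝ} (hr : 0 < r) (h : ∀ x ∈ closedBall z r, f x = f z → x = z) :
    ∃ δ > 0, ∀ x ∈ closedBall z r, r / 2 ≤ dist x z → δ ≤ dist (f x) (f z) := by
  have hK : IsCompact (closedBall z r ∩ {x | r / 2 ≤ dist x z}) :=
    (isCompact_closedBall z r).inter_right
      (isClosed_le continuous_const (continuous_id.dist continuous_const))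
  have hz : f z ∈ (f '' (closedBall z r ∩ {x | r / 2 ≤ dist x z}))ᶜ := by
    rintro ⟨x, ⟨hx, hx'⟩, hfx⟩
    have := h x hx hfx
    subst this
    simp only [Set.mem_ofPred_eq, dist_self] at hx'
    linarith
  obtain ⟨δ, hδ, hsub⟩ := Metric.isOpen_iff.1 (hK.image hf).isClosed.isOpen_compl _ hz
  refine ⟨δ, hδ, fun x hx hx' => ?_⟩
  by_contra! hlt
  exact hsub hlt ⟨x, ⟨hx, hx'⟩, rfl⟩

theorem exists_mem_eval_ne_zero {p : MvPolynomial (Fin n) ℝ} (hp : p ≠ 0) {U : Set (Fin n → ℝ)}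
    (hU : IsOpen U) (hne : U.Nonempty) : ∃ x ∈ U, eval x p ≠ 0 := by
  by_contra! h
  obtain ⟨x, hx⟩ := hne
  obtain ⟨ε, hε, hsub⟩ := Metric.isOpen_iff.1 hU x hx
  refine hp (funext_set (fun i => ball (x i) ε) (fun i => ?_) fun y hy => ?_)
  · rw [Real.ball_eq_Ioo]
    exact Set.Ioo_infinite (by linarith)
  · rw [map_zero]
    refine h y (hsub ?_)
    rw [ball_pi _ hε]
    exact hy

theorem isOpenMap_evalMap_of_nonneg (σ : ℝ) (hD0 : (jacobian P).det ≠ 0) (hσ : σ ≠ 0)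
    (hfin : ∀ a, (evalMap P ⁻¹' {a}).Finite)
    (hD : ∀ x, 0 ≤ σ * eval x (jacobian P).det) : IsOpenMap (evalMap P) := by
  refine IsOpenMap.of_nhds_le fun z => ?_
  have hiso : ∀ᶠ x in 𝓝 z, evalMap P x = evalMap P z → x = z := by
    have hcl : IsClosed (evalMap P ⁻¹' {evalMap P z} \ {z}) :=
      ((hfin _).subset Set.sdiff_subset).isClosed
    filter_upwards [hcl.isOpen_compl.mem_nhds (x := z) (by simp)] with x hx hFx
    by_contra hne
    exact hx ⟨hFx, hne⟩
  refine fun s hs => ?_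
  rw [Filter.mem_map] at hs
  obtain ⟨r, hr, hsub⟩ := Metric.nhds_basis_closedBall.mem_iff.1 (inter_mem hs hiso)
  obtain ⟨δ, hδ0, hδ⟩ := exists_pos_le_dist_of_isolated (continuous_evalMap P) hr
    fun x hx => (hsub hx).2
  obtain ⟨p, ⟨hp, hFp⟩, hDp⟩ := exists_mem_eval_ne_zero hD0
    (isOpen_ball.inter (isOpen_ball.preimage (continuous_evalMap P)))
    (⟨z, mem_ball_self hr, mem_ball_self (half_pos hδ0)⟩ :
      (ball z r ∩ evalMap P ⁻¹' ball (evalMap P z) (δ / 2)).Nonempty)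
  filter_upwards [ball_mem_nhds (evalMap P z) (half_pos hδ0)] with y hy
  have hcl : IsClosed (evalMap P '' closedBall z r) :=
    ((isCompact_closedBall z r).image (continuous_evalMap P)).isClosed
  have hmem : y ∈ closure (evalMap P '' closedBall z r) := by
    refine Metric.mem_closure_iff.2 fun ε hε => ?_
    obtain ⟨x, hx, hxy, -⟩ := exists_det_jacobian_pos_of_dist_lt P σ hr hδ hp hFp
      (lt_of_le_of_ne (hD p) (mul_ne_zero hσ hDp).symm) one_pos (fun x _ _ => hD x) hy hε
    exact ⟨_, ⟨x, ball_subset_closedBall hx, rfl⟩, by rwa [dist_comm]⟩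
  rw [hcl.closure_eq] at hmem
  obtain ⟨x, hx, rfl⟩ := hmem
  exact (hsub hx).1

theorem not_frequently_pos_and_neg_of_injOn {z : Fin n → ℝ} {U : Set (Fin n → ℝ)} (hU : U ∈ 𝓝 z)
    (hinj : Set.InjOn (evalMap P) U) (hpos : ∃ᶠ x in 𝓝 z, 0 < eval x (jacobian P).det)
    (hneg : ∃ᶠ x in 𝓝 z, eval x (jacobian P).det < 0) : False := by
  obtain ⟨r, hr, hsub⟩ := Metric.nhds_basis_closedBall.mem_iff.1 hU
  obtain ⟨δ, hδ0, hδ⟩ := exists_pos_le_dist_of_isolated (continuous_evalMap P) hr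
    fun x hx hxz => hinj (hsub hx) (hsub (mem_closedBall_self hr.le)) hxz
  have hN : ball z r ∩ evalMap P ⁻¹' ball (evalMap P z) (δ / 2) ∈ 𝓝 z :=
    inter_mem (ball_mem_nhds _ hr)
      ((continuous_evalMap P).continuousAt (ball_mem_nhds _ (half_pos hδ0)))
  have hDc := continuous_eval_real (jacobian P).det
  have hsep : ∀ σ : ℝ, ∀ p ∈ ball z r, 0 < σ * eval p (jacobian P).det → ∃ ε > 0, ∀ x ∈ ball z r,
      dist (evalMap P x) (evalMap P p) < ε → 0 < σ * eval x (jacobian P).det := by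
    intro σ p hp hDp
    have hK : IsCompact (closedBall z r ∩ {x | σ * eval x (jacobian P).det ≤ 0}) :=
      (isCompact_closedBall z r).inter_right (isClosed_le (continuous_const.mul hDc)
        continuous_const)
    have hz : evalMap P p ∈
        (evalMap P '' (closedBall z r ∩ {x | σ * eval x (jacobian P).det ≤ 0}))ᶜ := by
      rintro ⟨x, ⟨hx, hx'⟩, hFx⟩
      have := hinj (hsub hx) (hsub (ball_subset_closedBall hp)) hFx
      subst this
      exact absurd hDp (not_lt.2 hx')
    obtain ⟨ε, hε, hsub'⟩ :=
      Metric.isOpen_iff.1 (hK.image (continuous_evalMap P)).isClosed.isOpen_compl _ hz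
    refine ⟨ε, hε, fun x hx hxp => ?_⟩
    by_contra! hle
    exact hsub' hxp ⟨x, ⟨ball_subset_closedBall hx, hle⟩, rfl⟩
  obtain ⟨p, hDp, hp, hFp⟩ := (hpos.and_eventually hN).exists
  obtain ⟨q, hDq, hq, hFq⟩ := (hneg.and_eventually hN).exists
  obtain ⟨ε₀, hε₀, h₀⟩ := hsep 1 p hp (by linarith)
  obtain ⟨ε₁, hε₁, h₁⟩ := hsep (-1) q hq (by linarith)
  obtain ⟨x, hx, hxq, hDx⟩ := exists_det_jacobian_pos_of_dist_lt P 1 hr hδ hp hFp (by linarith) hε₀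
    (fun x hx hxp => (h₀ x hx hxp).le) hFq hε₁
  linarith [h₁ x hx hxq]

end MvPolynomial

end

section

open Module Metric Filter Topology

theorem LinearMap.exists_reflexive_inverse {E G : Type*} [AddCommGroup E] [Module ℝ E]
    [AddCommGroup G] [Module ℝ G] (A : E →ₗ[ℝ] G) :
    ∃ B : G →ₗ[ℝ] E, (∀ x, A (B (A x)) = A x) ∧ ∀ y, B (A (B y)) = B y := by
  obtain ⟨s, hs⟩ := A.rangeRestrict.exists_rightInverse_of_surjective A.range_rangeRestrict
  obtain ⟨π, hπ⟩ := (LinearMap.range A).subtype.exists_leftInverse_of_injective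
    (LinearMap.range A).ker_subtype
  have hs' : ∀ r : LinearMap.range A, A (s r) = r := fun r =>
    congrArg Subtype.val (LinearMap.congr_fun hs r)
  have hπ' : ∀ r : LinearMap.range A, π r = r := fun r => LinearMap.congr_fun hπ r
  refine ⟨s ∘ₗ π, fun x => ?_, fun y => ?_⟩
  · simp only [LinearMap.comp_apply, hs']
    exact congrArg Subtype.val (hπ' ⟨A x, x, rfl⟩)
  · simp only [LinearMap.comp_apply, hs', hπ']

/-- A `C¹` map with finite fibers is an immersion somewhere. -/
theorem ContDiffOn.exists_injective_fderiv_of_finite_fibers {E G : Type*}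
    [NormedAddCommGroup E] [NormedSpace ℝ E] [FiniteDimensional ℝ E]
    [NormedAddCommGroup G] [NormedSpace ℝ G] [FiniteDimensional ℝ G]
    {Φ : E → G} {O : Set E} (hΦ : ContDiffOn ℝ 1 Φ O) (hO : IsOpen O) (hne : O.Nonempty)
    (hfin : ∀ x ∈ O, (O ∩ Φ ⁻¹' {Φ x}).Finite) :
    ∃ x ∈ O, Function.Injective (fderiv ℝ Φ x) := by
  obtain ⟨x₀, hx₀, hmin⟩ : ∃ x₀ ∈ O, ∀ x ∈ O,
      finrank ℝ (LinearMap.ker (fderiv ℝ Φ x₀ : E →ₗ[ℝ] G)) ≤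
        finrank ℝ (LinearMap.ker (fderiv ℝ Φ x : E →ₗ[ℝ] G)) := by
    let d : E → ℕ := fun x => finrank ℝ (LinearMap.ker (fderiv ℝ Φ x : E →ₗ[ℝ] G))
    exact ⟨Function.argminOn d O hne, Function.argminOn_mem d O hne,
      fun x hx => Function.argminOn_le d O hx⟩
  refine ⟨x₀, hx₀, ?_⟩
  by_contra hinj
  set A₀ : E →ₗ[ℝ] G := (fderiv ℝ Φ x₀ : E →ₗ[ℝ] G) with hA₀
  obtain ⟨k, hk, hk0⟩ : ∃ k, A₀ k = 0 ∧ k ≠ 0 := by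
    by_contra! h
    exact hinj ((injective_iff_map_eq_zero (fderiv ℝ Φ x₀)).2 h)
  obtain ⟨B', hABA, hBAB⟩ := A₀.exists_reflexive_inverse
  set B : G →L[ℝ] E := LinearMap.toContinuousLinearMap B' with hB
  have hAt : ∀ x ∈ O, ContDiffAt ℝ 1 Φ x := fun x hx => hΦ.contDiffAt (hO.mem_nhds hx)
  set Q : E →L[ℝ] E := ContinuousLinearMap.id ℝ E - B ∘L fderiv ℝ Φ x₀ with hQ
  have hQA : ∀ x, A₀ (Q x) = 0 := by
    intro x
    have : Q x = x - B' (A₀ x) := rfl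
    rw [this, map_sub, hABA, sub_self]
  set χ : E → E := fun x => B (Φ x) + Q x with hχ
  have hχc : ∀ x ∈ O, ContDiffAt ℝ 1 χ x := fun x hx =>
    (B.contDiff.contDiffAt.comp x (hAt x hx)).add Q.contDiff.contDiffAt
  have hχd : ∀ x ∈ O, HasFDerivAt χ (B ∘L fderiv ℝ Φ x + Q) x := fun x hx =>
    (B.hasFDerivAt.comp x ((hAt x hx).differentiableAt one_ne_zero).hasFDerivAt).add Q.hasFDerivAt
  have hχ0 : HasFDerivAt χ ((ContinuousLinearEquiv.refl ℝ E : E ≃L[ℝ] E) : E →L[ℝ] E) x₀ := by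
    refine (hχd x₀ hx₀).congr_fderiv ?_
    ext v
    simp [hQ]
  set e := (hχc x₀ hx₀).toOpenPartialHomeomorph χ hχ0 one_ne_zero with he
  have hes : x₀ ∈ e.source := ContDiffAt.mem_toOpenPartialHomeomorph_source _ hχ0 one_ne_zero
  have heχ : ∀ x, e x = χ x := fun x => rfl
  have hcontd : ContinuousAt (fun x => B ∘L fderiv ℝ Φ x + Q) x₀ := by
    have : ContinuousAt (fderiv ℝ Φ) x₀ :=
      ((hΦ.continuousOn_fderiv_of_isOpen hO le_rfl).continuousAt (hO.mem_nhds hx₀))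
    fun_prop
  have hequiv : ∀ᶠ x in 𝓝 x₀, x ∈ O ∧ ∃ e' : E ≃L[ℝ] E, (e' : E →L[ℝ] E) =
      B ∘L fderiv ℝ Φ x + Q := by
    refine Filter.Eventually.and (hO.mem_nhds hx₀) ?_
    refine hcontd (U := Set.range ((↑) : (E ≃L[ℝ] E) → E →L[ℝ] E)) ?_
    have h1 : B ∘L fderiv ℝ Φ x₀ + Q = (ContinuousLinearEquiv.refl ℝ E : E →L[ℝ] E) := by
      ext v
      simp [hQ]
    change _ ∈ 𝓝 (B ∘L fderiv ℝ Φ x₀ + Q)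
    rw [h1]
    exact ContinuousLinearEquiv.nhds _
  have hker : ∀ x ∈ O, (∃ e' : E ≃L[ℝ] E, (e' : E →L[ℝ] E) = B ∘L fderiv ℝ Φ x + Q) →
      ∀ w, B (fderiv ℝ Φ x w) = 0 → fderiv ℝ Φ x w = 0 := by
    rintro x hx ⟨e', he'⟩
    have hle : LinearMap.ker (fderiv ℝ Φ x : E →ₗ[ℝ] G) ≤
        LinearMap.ker (B' ∘ₗ (fderiv ℝ Φ x : E →ₗ[ℝ] G)) := LinearMap.ker_le_ker_comp _ _
    have hmem : ∀ w ∈ LinearMap.ker (B' ∘ₗ (fderiv ℝ Φ x : E →ₗ[ℝ] G)),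
        (Q : E →ₗ[ℝ] E) w ∈ LinearMap.ker A₀ := fun w _ => hQA w
    have hQi : Function.Injective ((Q : E →ₗ[ℝ] E).restrict hmem) := by
      refine (injective_iff_map_eq_zero _).2 fun w hw => ?_
      have h1 : Q w = 0 := congrArg Subtype.val hw
      have h2 : B (fderiv ℝ Φ x w) = 0 := w.2
      have h3 : e' w = 0 := by
        change (e' : E →L[ℝ] E) w = 0
        rw [he']
        simp [h1, h2]
      exact Subtype.ext ((map_eq_zero_iff e' e'.injective).1 h3)
    have hrank := (LinearMap.finrank_le_finrank_of_injective hQi).trans (hmin x hx)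
    have heq := Submodule.eq_of_le_of_finrank_le hle hrank
    intro w hw
    have : w ∈ LinearMap.ker (B' ∘ₗ (fderiv ℝ Φ x : E →ₗ[ℝ] G)) := hw
    rwa [← heq] at this
  set c : ℝ → E := fun t => e.symm (e x₀ + t • k) with hc
  have hline : Continuous fun t : ℝ => e x₀ + t • k := by fun_prop
  have hev : ∀ᶠ t in 𝓝 (0 : ℝ), e x₀ + t • k ∈ e.target ∧
      (c t ∈ O ∧ ∃ e' : E ≃L[ℝ] E, (e' : E →L[ℝ] E) = B ∘L fderiv ℝ Φ (c t) + Q) := by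
    have h0 : e x₀ + (0 : ℝ) • k = e x₀ := by simp
    have h1 : Tendsto (fun t : ℝ => e x₀ + t • k) (𝓝 0) (𝓝 (e x₀)) := by
      simpa [h0] using hline.tendsto 0
    refine Filter.Eventually.and (h1 (e.open_target.mem_nhds (e.map_source hes))) ?_
    have h2 : Tendsto c (𝓝 0) (𝓝 x₀) := by
      have := (e.continuousAt_symm (e.map_source hes)).tendsto.comp h1
      rwa [e.left_inv hes] at this
    exact h2 hequiv
  obtain ⟨ε, hε, hball⟩ := Metric.eventually_nhds_iff_ball.1 hev
  have hright : ∀ t ∈ ball (0 : ℝ) ε, χ (c t) = e x₀ + t • k := fun t ht =>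
    e.right_inv (hball t ht).1
  have hderiv : ∀ t ∈ ball (0 : ℝ) ε, HasDerivAt (Φ ∘ c) 0 t := by
    intro t ht
    obtain ⟨htgt, htO, e', he'⟩ := hball t ht
    have h1 : HasFDerivAt e (e' : E →L[ℝ] E) (e.symm (e x₀ + t • k)) := by
      rw [he']
      exact hχd _ htO
    have h2 := e.hasFDerivAt_symm htgt h1
    have h3 : HasDerivAt (fun t : ℝ => e x₀ + t • k) k t := by
      simpa using ((hasDerivAt_id t).smul_const k).const_add (e x₀)
    have h4 : HasDerivAt c (e'.symm k) t := by
      have := HasFDerivAt.comp_hasDerivAt t h2 h3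
      exact this
    have h5 := ((hAt _ htO).differentiableAt one_ne_zero).hasFDerivAt.comp_hasDerivAt t h4
    refine h5.congr_deriv (hker _ htO ⟨e', he'⟩ _ ?_)
    set w := e'.symm k with hw
    have h6 : B (fderiv ℝ Φ (c t) w) + Q w = k := by
      have : (e' : E →L[ℝ] E) w = k := by simp [hw]
      rw [he'] at this
      exact this
    have h7 : A₀ (B (fderiv ℝ Φ (c t) w)) = 0 := by
      have := congrArg A₀ h6
      rwa [map_add, hQA, add_zero, hk] at this
    rw [show B (fderiv ℝ Φ (c t) w) = B' (A₀ (B' (fderiv ℝ Φ (c t) w))) from (hBAB _).symm]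
    exact (congrArg B' h7).trans (map_zero B')
  have hconst : ∀ t ∈ ball (0 : ℝ) ε, Φ (c t) = Φ (c 0) := fun t ht =>
    isOpen_ball.is_const_of_deriv_eq_zero (convex_ball _ _).isPreconnected
      (fun s hs => (hderiv s hs).differentiableAt.differentiableWithinAt)
      (fun s hs => (hderiv s hs).deriv) ht (mem_ball_self hε)
  have hc0 : c 0 = x₀ := by simp [hc, e.left_inv hes]
  have hcinj : Set.InjOn c (ball 0 ε) := by
    intro s hs t ht hst
    have := (hright s hs).symm.trans ((congrArg χ hst).trans (hright t ht))
    exact smul_left_injective ℝ hk0 (add_left_cancel this)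
  have hinf : (ball (0 : ℝ) ε).Infinite := by
    rw [Real.ball_eq_Ioo]
    exact Set.Ioo_infinite (by linarith)
  refine (hinf.image hcinj) ((hfin x₀ hx₀).subset ?_)
  rintro _ ⟨t, ht, rfl⟩
  exact ⟨(hball t ht).2.1, by rw [Set.mem_preimage, hconst t ht, hc0]; rfl⟩

/-- An open map whose derivative at a point has a kernel of dimension at most one is injective
near that point. -/
theorem IsOpenMap.exists_injOn_of_finrank_ker_le_one {E : Type*}
    [NormedAddCommGroup E] [NormedSpace ℝ E] [FiniteDimensional ℝ E] {F : E → E}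
    (hopen : IsOpenMap F) (hF : Continuous F) {A : E →L[ℝ] E} {z : E}
    (hA : HasStrictFDerivAt F A z) (hker : finrank ℝ (LinearMap.ker (A : E →ₗ[ℝ] E)) ≤ 1) :
    ∃ U ∈ 𝓝 z, Set.InjOn F U := by
  have hlocal : ∀ {f : E → E} {f' : E →L[ℝ] E}, HasStrictFDerivAt f f' z →
      (∀ v, f' v = 0 → v = 0) → ∃ e : OpenPartialHomeomorph E E, (∀ x, e x = f x) ∧
        z ∈ e.source := by
    intro f f' hf hinj
    let l : E ≃ₗ[ℝ] E := LinearEquiv.ofInjectiveEndo (f' : E →ₗ[ℝ] E)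
      ((injective_iff_map_eq_zero _).2 hinj)
    have hf2 : HasStrictFDerivAt f (l.toContinuousLinearEquiv : E →L[ℝ] E) z :=
      hf.congr_fderiv (by ext v; rfl)
    exact ⟨hf2.toOpenPartialHomeomorph f, fun x => rfl, hf2.mem_toOpenPartialHomeomorph_source⟩
  by_cases hbot : ∀ v, A v = 0 → v = 0
  · obtain ⟨e, hef, hes⟩ := hlocal hA hbot
    refine ⟨e.source, e.open_source.mem_nhds hes, fun x hx y hy hxy => e.injOn hx hy ?_⟩
    rw [hef, hef, hxy]
  push Not at hbot
  obtain ⟨k, hk, hk0⟩ := hbot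
  have hspan : ∀ v, A v = 0 → ∃ a : ℝ, a • k = v := by
    intro v hv
    have h1 : finrank ℝ (LinearMap.ker (A : E →ₗ[ℝ] E)) = 1 := by
      refine le_antisymm hker (Module.finrank_pos_iff_exists_ne_zero.2 ⟨⟨k, hk⟩, ?_⟩)
      simpa [Subtype.ext_iff] using hk0
    obtain ⟨a, ha⟩ := (finrank_eq_one_iff_of_nonzero' (⟨k, hk⟩ : LinearMap.ker (A : E →ₗ[ℝ] E))
      (by simpa [Subtype.ext_iff] using hk0)).1 h1 ⟨v, hv⟩
    exact ⟨a, congrArg Subtype.val ha⟩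
  obtain ⟨ℓ', hℓ0, hℓA⟩ : ∃ ℓ : E →ₗ[ℝ] ℝ, ℓ ≠ 0 ∧ LinearMap.range (A : E →ₗ[ℝ] E) ≤
      LinearMap.ker ℓ := by
    refine Submodule.exists_le_ker_of_lt_top _ (lt_top_iff_ne_top.2 fun htop => ?_)
    have hsurj := LinearMap.range_eq_top.1 htop
    exact hk0 ((LinearMap.injective_iff_surjective.2 hsurj) (hk.trans (map_zero A).symm))
  set ℓ : E →L[ℝ] ℝ := LinearMap.toContinuousLinearMap ℓ' with hℓ
  have hℓA' : ∀ v, ℓ (A v) = 0 := fun v => hℓA ⟨v, rfl⟩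
  obtain ⟨w, hw⟩ : ∃ w, ℓ w = 1 := by
    obtain ⟨w, hw⟩ : ∃ w, ℓ w ≠ 0 := by
      by_contra! h
      exact hℓ0 (LinearMap.ext h)
    exact ⟨(ℓ w)⁻¹ • w, by simp [hw]⟩
  obtain ⟨q, hq⟩ := SeparatingDual.exists_eq_one (R := ℝ) hk0
  set χ : E → E := fun x => F x + (q x - ℓ (F x)) • w with hχ
  have hχd : HasStrictFDerivAt χ (A + (q - ℓ ∘L A).smulRight w) z := by
    have h1 : HasStrictFDerivAt (fun x => q x - ℓ (F x)) (q - ℓ ∘L A) z :=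
      q.hasStrictFDerivAt.sub (ℓ.hasStrictFDerivAt.comp z hA)
    exact hA.add (h1.smul_const w)
  have hℓχ : ∀ x, ℓ (χ x) = q x := by
    intro x
    simp [hχ, hw]
  obtain ⟨e, heχ, hes⟩ := hlocal hχd (by
    intro v hv
    have h1 : A v + (q v - ℓ (A v)) • w = 0 := hv
    rw [hℓA', sub_zero] at h1
    have h2 : q v = 0 := by
      have := congrArg ℓ h1
      simpa [hℓA', hw] using this
    rw [h2, zero_smul, add_zero] at h1
    obtain ⟨a, rfl⟩ := hspan v h1
    rw [map_smul, hq, smul_eq_mul, mul_one] at h2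
    rw [h2, zero_smul])
  obtain ⟨s, hs, hsub⟩ := Metric.isOpen_iff.1 e.open_target (e z) (e.map_source hes)
  refine ⟨e.source ∩ e ⁻¹' ball (e z) s, inter_mem (e.open_source.mem_nhds hes)
    ((e.continuousAt hes) (ball_mem_nhds _ hs)), ?_⟩
  rintro x ⟨hx, hxs⟩ x' ⟨hx', hxs'⟩ hFx
  set c := q x' - q x with hc
  have hχc : χ x' = χ x + c • w := by
    simp only [hχ, hFx, hc, sub_smul]
    abel
  by_cases hc0 : c = 0
  · refine e.injOn hx hx' ?_
    rw [heχ, heχ, hχc, hc0, zero_smul, add_zero]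
  exfalso
  have hseg : ∀ τ ∈ Set.Icc (0 : ℝ) 1, χ x + (τ * c) • w ∈ e.target := by
    intro τ hτ
    refine hsub ?_
    have h1 := (convex_ball (e z) s).add_smul_sub_mem hxs hxs' hτ
    rw [heχ x, heχ x', hχc, add_sub_cancel_left, smul_smul] at h1
    exact h1
  set φ : ℝ → ℝ := fun τ => ℓ (F (e.symm (χ x + (τ * c) • w))) with hφ
  have hφc : ContinuousOn φ (Set.Icc 0 1) := by
    refine (ℓ.continuous.comp hF).comp_continuousOn (e.continuousOn_symm.comp ?_ hseg)
    fun_prop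
  have hφ01 : φ 0 = φ 1 := by
    have h1 : e.symm (χ x + ((0 : ℝ) * c) • w) = x := by
      rw [zero_mul, zero_smul, add_zero, ← heχ, e.left_inv hx]
    have h2 : e.symm (χ x + ((1 : ℝ) * c) • w) = x' := by
      rw [one_mul, ← hχc, ← heχ, e.left_inv hx']
    simp only [hφ, h1, h2, hFx]
  obtain ⟨τ₀, hτ₀, hext⟩ := exists_isLocalExtr_Ioo one_pos hφc hφ01
  set x₀ := e.symm (χ x + (τ₀ * c) • w) with hx₀
  have htgt := hseg τ₀ ⟨hτ₀.1.le, hτ₀.2.le⟩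
  have hx₀s : x₀ ∈ e.source := e.map_target htgt
  have hχx₀ : χ x₀ = χ x + (τ₀ * c) • w := by
    rw [← heχ x₀, hx₀, e.right_inv htgt]
  have hqx₀ : q x₀ = q x + τ₀ * c := by
    rw [← hℓχ, hχx₀, map_add, hℓχ, map_smul, hw, smul_eq_mul, mul_one]
  set T : E → ℝ := fun y => (q y - q x) / c with hT
  have hTx₀ : T x₀ = τ₀ := by
    simp only [hT, hqx₀]
    field_simp
    ring
  have hTc : Tendsto T (𝓝 x₀) (𝓝 τ₀) := by
    have : Continuous T := by fun_prop
    simpa only [hTx₀] using this.tendsto x₀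
  have hwalk : ∀ p : ℝ → Prop, (∀ᶠ τ in 𝓝 τ₀, p (φ τ)) →
      ∀ᶠ ε in 𝓝 (0 : ℝ), p (φ τ₀ + ε) := by
    intro p hp
    have hN : e.source ∩ {y | p (φ (T y))} ∈ 𝓝 x₀ :=
      inter_mem (e.open_source.mem_nhds hx₀s) (hTc hp)
    have h1 := hopen.image_mem_nhds hN
    have h2 : Tendsto (fun ε : ℝ => F x₀ + ε • w) (𝓝 0) (𝓝 (F x₀)) := by
      have : Continuous fun ε : ℝ => F x₀ + ε • w := by fun_prop
      simpa using this.tendsto 0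
    filter_upwards [h2 h1] with ε hε
    obtain ⟨y, ⟨hy, hpy⟩, hFy⟩ := hε
    have hχy : χ y = χ x + (T y * c) • w := by
      have h3 : T y * c = q y - q x := div_mul_cancel₀ _ hc0
      have h4 : χ y = χ x₀ + (q y - q x₀) • w := by
        simp only [hχ, hFy, map_add, map_smul, hw, smul_eq_mul, mul_one, sub_smul, add_smul]
        abel
      rw [h4, hχx₀, hqx₀, h3, add_assoc, ← add_smul]
      congr 2
      ring
    have h5 : φ (T y) = φ τ₀ + ε := by
      have h6 : e.symm (χ x + (T y * c) • w) = y := by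
        rw [← hχy, ← heχ, e.left_inv hy]
      simp only [hφ, h6, hFy, map_add, map_smul, hw, smul_eq_mul, mul_one]
      rfl
    have h7 : p (φ (T y)) := hpy
    rwa [h5] at h7
  rcases hext with hmin | hmax
  · have h1 := hwalk (fun a => φ τ₀ ≤ a) hmin
    obtain ⟨ε, h2, h3⟩ := ((h1.filter_mono nhdsWithin_le_nhds).and
      (self_mem_nhdsWithin (a := (0 : ℝ)) (s := Set.Iio 0))).exists
    have h4 : ε < 0 := h3
    linarith
  · have h1 := hwalk (fun a => a ≤ φ τ₀) hmax
    obtain ⟨ε, h2, h3⟩ := ((h1.filter_mono nhdsWithin_le_nhds).and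
      (self_mem_nhdsWithin (a := (0 : ℝ)) (s := Set.Ioi 0))).exists
    have h4 : 0 < ε := h3
    linarith

end

section

namespace MvPolynomial

variable {n : ℕ}

theorem exists_polynomial_relation (P : Fin n → MvPolynomial (Fin n) ℝ) (j : Fin n) :
    ∃ q : Polynomial (MvPolynomial (Fin n) ℝ), q ≠ 0 ∧
      ∀ x, (q.map (eval (evalMap P x))).eval (x j) = 0 := by
  set f : Option (Fin n) → MvPolynomial (Fin n) ℝ := fun o => o.elim (X j) P with hf
  have hdep : ¬ AlgebraicIndependent ℝ f := by
    intro h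
    have h1 := h.cardinalMk_le_trdeg
    rw [MvPolynomial.trdeg_of_isDomain, Cardinal.mk_option, Cardinal.mk_fin,
      Cardinal.lift_natCast] at h1
    have h2 : n + 1 ≤ n := by exact_mod_cast h1
    omega
  rw [algebraicIndependent_iff] at hdep
  push Not at hdep
  obtain ⟨Q, hQ, hQ0⟩ := hdep
  refine ⟨optionEquivLeft ℝ (Fin n) Q, by simpa using hQ0, fun x => ?_⟩
  have key : ((Polynomial.evalRingHom (x j)).comp
      (Polynomial.mapRingHom (eval (evalMap P x)))).comp
        (optionEquivLeft ℝ (Fin n) : MvPolynomial (Option (Fin n)) ℝ →+* _) =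
      (eval x).comp (aeval f : MvPolynomial (Option (Fin n)) ℝ →ₐ[ℝ] _).toRingHom := by
    refine MvPolynomial.ringHom_ext (fun r => ?_) fun o => ?_
    · simp
    · cases o <;> simp [hf, evalMap]
  refine (RingHom.congr_fun key Q).trans ?_
  change eval x (aeval f Q) = 0
  rw [hQ, map_zero]

theorem exists_card_fiber_le (P : Fin n → MvPolynomial (Fin n) ℝ) :
    ∃ (c : MvPolynomial (Fin n) ℝ) (N : ℕ), c ≠ 0 ∧
      ∀ y, eval y c ≠ 0 → ∀ s : Finset (Fin n → ℝ), (∀ x ∈ s, evalMap P x = y) → s.card ≤ N := by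
  choose q hq0 hq using exists_polynomial_relation P
  refine ⟨∏ j, (q j).leadingCoeff, ∏ j, (q j).natDegree,
    Finset.prod_ne_zero_iff.2 fun j _ => Polynomial.leadingCoeff_ne_zero.2 (hq0 j), ?_⟩
  intro y hy s hs
  rw [map_prod, Finset.prod_ne_zero_iff] at hy
  have hsub : s ⊆ Fintype.piFinset fun j => ((q j).map (eval y)).roots.toFinset := by
    intro x hx
    rw [Fintype.mem_piFinset]
    intro j
    have h0 : (q j).map (eval y) ≠ 0 := by
      intro h
      refine hy j (Finset.mem_univ j) ?_
      simpa using congrArg (fun r => Polynomial.coeff r (q j).natDegree) h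
    rw [Multiset.mem_toFinset, Polynomial.mem_roots h0, Polynomial.IsRoot, ← hs x hx]
    exact hq j x
  refine (Finset.card_le_card hsub).trans ?_
  rw [Fintype.card_piFinset]
  exact Finset.prod_le_prod' fun j _ => (Multiset.toFinset_card_le _).trans
    ((Polynomial.card_roots' _).trans Polynomial.natDegree_map_le)

theorem finite_fiber_of_isOpenMap (P : Fin n → MvPolynomial (Fin n) ℝ)
    (hopen : IsOpenMap (evalMap P)) (a : Fin n → ℝ) : (evalMap P ⁻¹' {a}).Finite := by
  by_contra hinf
  obtain ⟨c, N, hc, hN⟩ := exists_card_fiber_le P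
  obtain ⟨s, hs, hcard⟩ := Set.Infinite.exists_subset_card_eq hinf (N + 1)
  obtain ⟨U, hU, hdisj⟩ := s.finite_toSet.t2_separation
  have himg : ∀ x, IsOpen (evalMap P '' U x) := fun x => hopen _ (hU x).2
  obtain ⟨y, hy, hyc⟩ := exists_mem_eval_ne_zero hc
    (isOpen_biInter_finset (s := s) fun x _ => himg x)
    ⟨a, Set.mem_iInter₂.2 fun x hx => ⟨x, (hU x).1, hs hx⟩⟩
  have hy' : ∀ x : s, ∃ x' ∈ U x, evalMap P x' = y := fun x => Set.mem_iInter₂.1 hy x x.2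
  choose g hgU hg using hy'
  have hinj : Function.Injective g := by
    intro x x' hxx
    by_contra hne
    exact Set.disjoint_left.1 (hdisj x.2 x'.2 fun h => hne (Subtype.ext h)) (hgU x)
      (hxx ▸ hgU x')
  have := hN y hyc (Finset.univ.map ⟨g, hinj⟩) fun x hx => by
    obtain ⟨x', -, rfl⟩ := Finset.mem_map.1 hx
    exact hg x'
  rw [Finset.card_map, Finset.card_univ, Fintype.card_coe, hcard] at this
  omega

end MvPolynomial

end

section

open Module Metric Filter Topology

theorem Polynomial.exists_sign_change {p : Polynomial ℝ} {a b : ℝ} (ha : 0 < p.eval a)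
    (hb : p.eval b < 0) :
    ∃ t ∈ Set.uIcc a b, (∃ᶠ s in 𝓝 t, 0 < p.eval s) ∧ ∃ᶠ s in 𝓝 t, p.eval s < 0 := by
  by_contra! hcon
  have hU : IsOpen {t | ∀ᶠ s in 𝓝 t, p.eval s ≤ 0} := isOpen_setOfPred_eventually_nhds
  have hV : IsOpen {t | ∀ᶠ s in 𝓝 t, 0 ≤ p.eval s} := isOpen_setOfPred_eventually_nhds
  obtain ⟨t, -, htU, htV⟩ := isPreconnected_uIcc (a := a) (b := b) _ _ hU hV
    (fun t ht => by
      by_cases h : ∃ᶠ s in 𝓝 t, 0 < p.eval s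
      · exact Or.inr (hcon t ht h)
      · exact Or.inl ((Filter.not_frequently.1 h).mono fun s hs => not_lt.1 hs))
    ⟨b, Set.right_mem_uIcc, (p.continuous.tendsto b).eventually (ge_mem_nhds hb)⟩
    ⟨a, Set.left_mem_uIcc, (p.continuous.tendsto a).eventually (le_mem_nhds ha)⟩
  have hzero : ∀ᶠ s in 𝓝 t, p.eval s = 0 := by
    filter_upwards [htU, htV] with s h1 h2 using le_antisymm h1 h2
  obtain ⟨ε, hε, hball⟩ := Metric.eventually_nhds_iff_ball.1 hzero
  have hp : p = 0 := by
    refine Polynomial.eq_zero_of_infinite_isRoot p ((Set.Infinite.mono fun s hs => hball s hs) ?_)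
    rw [Real.ball_eq_Ioo]
    exact Set.Ioo_infinite (by linarith)
  rw [hp, Polynomial.eval_zero] at ha
  exact ha.false

theorem Polynomial.exists_iterate_derivative_eval_zero_ne_zero {p : Polynomial ℝ} (hp : p ≠ 0) :
    ∃ k, (Polynomial.derivative^[k] p).eval 0 ≠ 0 := by
  by_contra! h
  refine hp (Polynomial.ext fun k => ?_)
  have h1 := h k
  rw [← Polynomial.coeff_zero_eq_eval_zero, Polynomial.coeff_iterate_derivative, zero_add,
    Nat.descFactorial_self, smul_eq_zero] at h1
  exact h1.resolve_left (Nat.factorial_ne_zero k)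

namespace MvPolynomial

variable {n : ℕ}

/-- The restriction of a polynomial to the line through `x` with direction `e`. -/
noncomputable def restrictLine (x e : Fin n → ℝ) :
    MvPolynomial (Fin n) ℝ →ₐ[ℝ] Polynomial ℝ :=
  aeval fun i => Polynomial.C (x i) + Polynomial.C (e i) * Polynomial.X

theorem eval_restrictLine (x e : Fin n → ℝ) (p : MvPolynomial (Fin n) ℝ) (t : ℝ) :
    (restrictLine x e p).eval t = eval (x + t • e) p := by
  have : (Polynomial.evalRingHom t).comp (restrictLine x e : MvPolynomial (Fin n) ℝ →+* _) =
      eval (x + t • e) := by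
    refine MvPolynomial.ringHom_ext (fun r => ?_) fun i => ?_
    · simp [restrictLine]
    · simp [restrictLine, mul_comm t]
  exact RingHom.congr_fun this p

/-- The derivative of a polynomial in the direction `e`. -/
noncomputable def dirDeriv (e : Fin n → ℝ) :
    Derivation ℝ (MvPolynomial (Fin n) ℝ) (MvPolynomial (Fin n) ℝ) :=
  mkDerivation ℝ fun i => C (e i)

theorem derivative_restrictLine (x e : Fin n → ℝ) (p : MvPolynomial (Fin n) ℝ) :
    Polynomial.derivative (restrictLine x e p) = restrictLine x e (dirDeriv e p) := by
  induction p using MvPolynomial.induction_on with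
  | C r => simp [restrictLine, dirDeriv]
  | add p q hp hq => simp only [map_add, hp, hq]
  | mul_X p i hp =>
    have hX : Polynomial.derivative (restrictLine x e (X i)) =
        restrictLine x e (dirDeriv e (X i)) := by
      simp [restrictLine, dirDeriv]
    rw [map_mul, Polynomial.derivative_mul, hp, hX, Derivation.leibniz]
    simp only [smul_eq_mul, map_add, map_mul]
    ring

theorem iterate_derivative_restrictLine (x e : Fin n → ℝ) (p : MvPolynomial (Fin n) ℝ) (k : ℕ) :
    Polynomial.derivative^[k] (restrictLine x e p) = restrictLine x e ((dirDeriv e)^[k] p) := by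
  induction k with
  | zero => rfl
  | succ k ih => rw [Function.iterate_succ_apply', Function.iterate_succ_apply', ih,
      derivative_restrictLine]

/-- If a polynomial takes both signs, then on some hypersurface graph it changes sign along a
fixed direction transverse to the hypersurface. -/
theorem exists_sign_change_graph {D : MvPolynomial (Fin n) ℝ} {p q : Fin n → ℝ}
    (hp : 0 < eval p D) (hq : eval q D < 0) (H : Submodule ℝ (Fin n → ℝ)) :
    ∃ (x₀ : Fin n → ℝ) (ψ : H → ℝ) (O : Set H), IsOpen O ∧ O.Nonempty ∧ ContDiffOn ℝ 1 ψ O ∧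
      ∀ u ∈ O, ∀ z, z = x₀ + (u : Fin n → ℝ) + ψ u • (q - p) →
        (∃ᶠ x in 𝓝 z, 0 < eval x D) ∧ ∃ᶠ x in 𝓝 z, eval x D < 0 := by
  set e := q - p with he
  let S : Set (Fin n → ℝ) := {x | (∃ᶠ t in 𝓝 (0 : ℝ), 0 < eval (x + t • e) D) ∧
    ∃ᶠ t in 𝓝 (0 : ℝ), eval (x + t • e) D < 0}
  have hS : ∀ (x : Fin n → ℝ) (t₁ t₂ : ℝ), 0 < eval (x + t₁ • e) D → eval (x + t₂ • e) D < 0 →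
      ∃ t ∈ Set.uIcc t₁ t₂, x + t • e ∈ S := by
    intro x t₁ t₂ h₁ h₂
    obtain ⟨t, ht, hpos, hneg⟩ := Polynomial.exists_sign_change (p := restrictLine x e D)
      (a := t₁) (b := t₂) (by rwa [eval_restrictLine]) (by rwa [eval_restrictLine])
    have hshift : Tendsto (fun s : ℝ => s - t) (𝓝 t) (𝓝 0) := by
      have : Continuous fun s : ℝ => s - t := by fun_prop
      simpa using this.tendsto t
    have hline : ∀ s : ℝ, x + t • e + (s - t) • e = x + s • e := fun s => by
      rw [add_assoc, ← add_smul, add_sub_cancel]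
    refine ⟨t, ht, hshift.frequently (hpos.mono fun s hs => ?_),
      hshift.frequently (hneg.mono fun s hs => ?_)⟩
    · rwa [hline, ← eval_restrictLine]
    · rwa [hline, ← eval_restrictLine]
  have hS0 : ∀ x ∈ S, eval x D = 0 := by
    rintro x ⟨h1, h2⟩
    have hc : Tendsto (fun t : ℝ => eval (x + t • e) D) (𝓝 0) (𝓝 (eval x D)) := by
      have : Continuous fun t : ℝ => eval (x + t • e) D :=
        (continuous_eval_real D).comp (by fun_prop)
      simpa using this.tendsto 0
    refine le_antisymm (le_of_not_gt fun h => h2 ?_) (le_of_not_gt fun h => h1 ?_)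
    · filter_upwards [hc (Ioi_mem_nhds h)] with t ht using not_lt.2 (le_of_lt ht)
    · filter_upwards [hc (Iio_mem_nhds h)] with t ht using not_lt.2 (le_of_lt ht)
  have hne : ∃ k, ∃ x ∈ S, eval x ((dirDeriv e)^[k] D) ≠ 0 := by
    obtain ⟨t, -, ht⟩ := hS p 0 1 (by simpa using hp) (by simpa [he] using hq)
    have hD : restrictLine (p + t • e) e D ≠ 0 := by
      intro h
      obtain ⟨s, hs⟩ := ht.1.exists
      rw [← eval_restrictLine, h, Polynomial.eval_zero] at hs
      exact hs.false
    obtain ⟨k, hk⟩ := Polynomial.exists_iterate_derivative_eval_zero_ne_zero hD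
    refine ⟨k, p + t • e, ht, ?_⟩
    rw [iterate_derivative_restrictLine, eval_restrictLine] at hk
    simpa using hk
  classical
  obtain ⟨m, hm⟩ : ∃ m, Nat.find hne = m + 1 := by
    refine Nat.exists_eq_succ_of_ne_zero fun h => ?_
    obtain ⟨x, hx, hxD⟩ := Nat.find_spec hne
    rw [h] at hxD
    exact hxD (hS0 x hx)
  obtain ⟨x₀, hx₀, hx₀D⟩ := Nat.find_spec hne
  set h := (dirDeriv e)^[m] D with hh
  have hhS : ∀ x ∈ S, eval x h = 0 := by
    intro x hx
    by_contra hcon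
    exact Nat.find_min hne (m := m) (by omega) ⟨x, hx, hcon⟩
  rw [hm, Function.iterate_succ_apply', ← hh] at hx₀D
  set c := eval x₀ (dirDeriv e h) with hc
  set f : H × ℝ → ℝ := fun v => eval (x₀ + (v.1 : Fin n → ℝ) + v.2 • e) h with hf
  have hpt : Continuous fun v : H × ℝ => x₀ + (v.1 : Fin n → ℝ) + v.2 • e := by fun_prop
  have hptd : ContDiff ℝ 1 fun v : H × ℝ => x₀ + (v.1 : Fin n → ℝ) + v.2 • e :=
    (contDiff_const.add (H.subtypeL.contDiff.comp contDiff_fst)).add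
      (contDiff_snd.smul contDiff_const)
  have hfd : ContDiff ℝ 1 f := (contDiff_eval h).comp hptd
  have hf0 : f (0, 0) = 0 := by
    simp only [hf, Submodule.coe_zero, add_zero, zero_smul]
    exact hhS x₀ hx₀
  have hinr : fderiv ℝ f (0, 0) (0, 1) = c := by
    have h1 : HasDerivAt (fun t : ℝ => f (0, t)) (fderiv ℝ f (0, 0) (0, 1)) 0 :=
      HasFDerivAt.comp_hasDerivAt (f := fun t : ℝ => ((0 : H), t)) (0 : ℝ)
        ((hfd.differentiable one_ne_zero) (0, 0)).hasFDerivAt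
        ((hasDerivAt_const (0 : ℝ) (0 : H)).prodMk (hasDerivAt_id (0 : ℝ)))
    have h2 : HasDerivAt (fun t : ℝ => f (0, t)) c 0 := by
      have h3 := (restrictLine x₀ e h).hasDerivAt 0
      rw [derivative_restrictLine, eval_restrictLine, zero_smul, add_zero] at h3
      refine h3.congr_of_eventuallyEq (Eventually.of_forall fun t => ?_)
      simp only [hf, Submodule.coe_zero, add_zero, eval_restrictLine]
    exact h1.unique h2
  have if₂ : (fderiv ℝ f (0, 0) ∘L .inr ℝ H ℝ).IsInvertible := by
    refine ⟨ContinuousLinearEquiv.unitsEquivAut ℝ (Units.mk0 c hx₀D), ?_⟩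
    ext
    simp [hinr]
  have hcd : ContDiffAt ℝ 1 f (0, 0) := hfd.contDiffAt
  set ψ : H → ℝ := hcd.implicitFunction one_ne_zero if₂ with hψ
  have hψd : ContDiffAt ℝ 1 ψ (0 : H) := hcd.contDiffAt_implicitFunction one_ne_zero if₂
  have hiff := hcd.eventually_apply_eq_iff_implicitFunction one_ne_zero if₂
  rw [nhds_prod_eq, eventually_prod_iff] at hiff
  obtain ⟨pU, hpU, pV, hpV, hUV⟩ := hiff
  obtain ⟨δ, hδ, hδV⟩ := Metric.eventually_nhds_iff_ball.1 hpV
  obtain ⟨t₁, h₁, ht₁⟩ := (hx₀.1.and_eventually (ball_mem_nhds (0 : ℝ) hδ)).exists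
  obtain ⟨t₂, h₂, ht₂⟩ := (hx₀.2.and_eventually (ball_mem_nhds (0 : ℝ) hδ)).exists
  have hcont : ∀ t : ℝ, Tendsto (fun u : H => eval (x₀ + (u : Fin n → ℝ) + t • e) D) (𝓝 0)
      (𝓝 (eval (x₀ + t • e) D)) := by
    intro t
    have : Continuous fun u : H => eval (x₀ + (u : Fin n → ℝ) + t • e) D :=
      (continuous_eval_real D).comp (by fun_prop)
    simpa using this.tendsto 0
  have hmain : ∀ᶠ u : H in 𝓝 0, x₀ + (u : Fin n → ℝ) + ψ u • e ∈ S := by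
    filter_upwards [hpU, hcont t₁ (Ioi_mem_nhds h₁), hcont t₂ (Iio_mem_nhds h₂)] with u hu hu₁ hu₂
    obtain ⟨t, ht, htS⟩ := hS (x₀ + u) t₁ t₂ hu₁ hu₂
    have htb : t ∈ ball (0 : ℝ) δ := by
      have hoc : (ball (0 : ℝ) δ).OrdConnected := (convex_ball (0 : ℝ) δ).ordConnected
      exact hoc.uIcc_subset ht₁ ht₂ ht
    have := (hUV hu (hδV t htb)).1 ((hhS _ htS).trans hf0.symm)
    rw [show ψ u = t from this]
    exact htS
  obtain ⟨O, hO, hOo, hO0⟩ := _root_.eventually_nhds_iff.1 (hmain.and (hψd.eventually (by simp)))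
  refine ⟨x₀, ψ, O, hOo, ⟨0, hO0⟩, fun u hu => (hO u hu).2.contDiffWithinAt, ?_⟩
  rintro u hu z rfl
  have hline : Tendsto (fun t : ℝ => x₀ + (u : Fin n → ℝ) + ψ u • e + t • e) (𝓝 0)
      (𝓝 (x₀ + (u : Fin n → ℝ) + ψ u • e)) := by
    have : Continuous fun t : ℝ => x₀ + (u : Fin n → ℝ) + ψ u • e + t • e := by fun_prop
    simpa using this.tendsto 0
  exact ⟨hline.frequently (hO u hu).1.1, hline.frequently (hO u hu).1.2⟩

theorem det_jacobian_semidefinite_of_isOpenMap (P : Fin n → MvPolynomial (Fin n) ℝ)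
    (hopen : IsOpenMap (evalMap P)) :
    (∀ x, 0 ≤ eval x (jacobian P).det) ∨ ∀ x, eval x (jacobian P).det ≤ 0 := by
  by_contra! hcon
  obtain ⟨⟨q, hq⟩, p, hp⟩ := hcon
  have he : q - p ≠ 0 := by
    intro h
    rw [sub_eq_zero.1 h] at hq
    exact (hp.trans hq).false
  obtain ⟨ℓ, hℓ⟩ := SeparatingDual.exists_eq_one (R := ℝ) he
  set H : Submodule ℝ (Fin n → ℝ) := LinearMap.ker (ℓ : (Fin n → ℝ) →ₗ[ℝ] ℝ) with hH
  obtain ⟨x₀, ψ, O, hO, hne, hψ, hsign⟩ := exists_sign_change_graph hp hq H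
  set e := q - p
  set γ : H → Fin n → ℝ := fun u => x₀ + (u : Fin n → ℝ) + ψ u • e with hγ
  have hγd : ContDiffOn ℝ 1 γ O :=
    (contDiff_const.add H.subtypeL.contDiff).contDiffOn.add (hψ.smul contDiffOn_const)
  have hγinj : Function.Injective γ := by
    intro u v huv
    have h0 : ∀ u : H, ℓ u = 0 := fun u => u.2
    have h1 : ψ u = ψ v := by
      have := congrArg ℓ huv
      simpa [hγ, h0, hℓ] using this
    simpa [hγ, h1] using huv
  have hd : ContDiffOn ℝ 1 (evalMap P ∘ γ) O := (contDiff_evalMap P).comp_contDiffOn hγd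
  obtain ⟨u, hu, hinj⟩ := hd.exists_injective_fderiv_of_finite_fibers hO hne fun u _ =>
    ((finite_fiber_of_isOpenMap P hopen (evalMap P (γ u))).preimage hγinj.injOn).subset
      fun v hv => hv.2
  set A := LinearMap.toContinuousLinearMap (Matrix.toLin' ((jacobian P).map (eval (γ u)))) with hA
  have hAd : HasStrictFDerivAt (evalMap P) A (γ u) := hasStrictFDerivAt_evalMap P (γ u)
  have hγu : HasFDerivAt γ (fderiv ℝ γ u) u :=
    ((hγd.contDiffAt (hO.mem_nhds hu)).differentiableAt one_ne_zero).hasFDerivAt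
  rw [(hAd.hasFDerivAt.comp u hγu).fderiv] at hinj
  have hker : finrank ℝ (LinearMap.ker (A : (Fin n → ℝ) →ₗ[ℝ] Fin n → ℝ)) ≤ 1 := by
    have h1 : finrank ℝ H ≤ finrank ℝ (LinearMap.range (A : (Fin n → ℝ) →ₗ[ℝ] Fin n → ℝ)) := by
      refine LinearMap.finrank_le_finrank_of_injective
        (f := (A : (Fin n → ℝ) →ₗ[ℝ] Fin n → ℝ).rangeRestrict ∘ₗ
          (fderiv ℝ γ u : H →ₗ[ℝ] Fin n → ℝ)) fun v w hvw => hinj ?_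
      exact congrArg Subtype.val hvw
    have h2 := LinearMap.finrank_range_add_finrank_ker (A : (Fin n → ℝ) →ₗ[ℝ] Fin n → ℝ)
    have h3 := LinearMap.finrank_range_add_finrank_ker (ℓ : (Fin n → ℝ) →ₗ[ℝ] ℝ)
    have h4 : finrank ℝ (LinearMap.range (ℓ : (Fin n → ℝ) →ₗ[ℝ] ℝ)) ≤ 1 :=
      (Submodule.finrank_le _).trans (finrank_self ℝ).le
    rw [← h2, ← hH] at h3
    omega
  obtain ⟨U, hU, hUinj⟩ := hopen.exists_injOn_of_finrank_ker_le_one (continuous_evalMap P) hAd hker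
  exact not_frequently_pos_and_neg_of_injOn P hU hUinj (hsign u hu _ rfl).1 (hsign u hu _ rfl).2

theorem det_jacobian_ne_zero_of_finite_fibers (P : Fin n → MvPolynomial (Fin n) ℝ)
    (hfin : ∀ a, (evalMap P ⁻¹' {a}).Finite) : (jacobian P).det ≠ 0 := by
  intro h0
  have hd : ContDiffOn ℝ 1 (evalMap P) Set.univ := (contDiff_evalMap P).contDiffOn
  obtain ⟨x, -, hinj⟩ := hd.exists_injective_fderiv_of_finite_fibers isOpen_univ
    Set.univ_nonempty fun x _ => (hfin _).inter_of_right _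
  rw [(hasStrictFDerivAt_evalMap P x).hasFDerivAt.fderiv] at hinj
  have h1 : ((jacobian P).map (eval x)).det = 0 := by
    rw [← eval_det_jacobian, h0, map_zero]
  obtain ⟨v, hv, hMv⟩ := Matrix.exists_mulVec_eq_zero_iff.2 h1
  refine hv (hinj ?_)
  simpa using hMv

theorem isOpenMap_evalMap_iff (P : Fin n → MvPolynomial (Fin n) ℝ) :
    IsOpenMap (evalMap P) ↔ (∀ a, (evalMap P ⁻¹' {a}).Finite) ∧
      ((∀ x, 0 ≤ eval x (jacobian P).det) ∨ ∀ x, eval x (jacobian P).det ≤ 0) := by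
  refine ⟨fun h => ⟨finite_fiber_of_isOpenMap P h, det_jacobian_semidefinite_of_isOpenMap P h⟩, ?_⟩
  rintro ⟨hfin, hD | hD⟩
  · exact isOpenMap_evalMap_of_nonneg P 1 (det_jacobian_ne_zero_of_finite_fibers P hfin)
      one_ne_zero hfin fun x => by simpa using hD x
  · exact isOpenMap_evalMap_of_nonneg P (-1) (det_jacobian_ne_zero_of_finite_fibers P hfin)
      (by norm_num) hfin fun x => by simpa using hD x

end MvPolynomial

end

/-- A polynomial mapping F : ℝⁿ → ℝⁿ is open iff all its fibers are finite
and the sign of det JF does not change (everywhere ≥ 0 or everywhere ≤ 0). -/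
theorem stmt_10 (n : ℕ) (P : Fin n → MvPolynomial (Fin n) ℝ) :
    IsOpenMap (fun x : Fin n → ℝ => fun i => eval x (P i)) ↔
      ((∀ a : Fin n → ℝ,
          ((fun x : Fin n → ℝ => fun i => eval x (P i)) ⁻¹' {a}).Finite) ∧
        ((∀ x : Fin n → ℝ,
            0 ≤ Matrix.det (Matrix.of fun i j => eval x (pderiv j (P i)))) ∨
          (∀ x : Fin n → ℝ,
            Matrix.det (Matrix.of fun i j => eval x (pderiv j (P i))) ≤ 0))) := by
  have h := isOpenMap_evalMap_iff P
  simp only [eval_det_jacobian] at h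
  exact h
end

section
/- Suppose that for every n ≥ 2 and every polynomial mapping of cubic homogeneous form F = I + H : ℝⁿ → ℝⁿ (i.e. F_i(x) = x_i + H_i(x) with each H_i either zero or a homogeneous polynomial of degree 3) with nonzero constant Jacobian determinant, F is injective. Then for every n ≥ 2, every polynomial mapping F : ℝⁿ → ℝⁿ with nonzero constant Jacobian determinant is injective. -/
open MvPolynomial

section
variable {σ τ : Type}

theorem pderiv_rename_inl_inr (p : MvPolynomial σ ℝ) (k : τ) :
    pderiv (Sum.inr k : σ ⊕ τ) (rename Sum.inl p) = 0 := by
  classical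
  refine pderiv_eq_zero_of_notMem_vars fun h => ?_
  simpa using vars_rename _ _ h

theorem eval_pderiv_bind₁ [Fintype τ] (w : τ → MvPolynomial σ ℝ)
    (h : MvPolynomial τ ℝ) (x : σ → ℝ) (j : σ) :
    eval x (pderiv j (bind₁ w h)) =
      ∑ k, eval x (bind₁ w (pderiv k h)) * eval x (pderiv j (w k)) := by
  classical
  induction h using MvPolynomial.induction_on with
  | C a => simp
  | add p q hp hq => simp [hp, hq, add_mul, Finset.sum_add_distrib]
  | mul_X p i hp =>
    simp [hp, add_mul, Finset.sum_add_distrib, pderiv_X, Pi.single_apply, Finset.mul_sum]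
    simp [mul_comm, mul_left_comm, apply_ite]

theorem eval_smul_of_isHomogeneous {p : MvPolynomial σ ℝ} {n : ℕ} (hp : p.IsHomogeneous n)
    (t : ℝ) (x : σ → ℝ) : eval (t • x) p = t ^ n * eval x p := by
  rw [eval_eq, eval_eq, Finset.mul_sum]
  refine Finset.sum_congr rfl fun d hd => ?_
  have := hp.degree_eq_sum_deg_support hd
  simp [mul_pow, Finset.prod_mul_distrib, Finset.prod_pow_eq_pow_sum, this]
  ring

/-- The map `(x, y) ↦ (F(x, y) + h(w), w)` with `w = y + A(x)`. -/
noncomputable def shear (F : σ → MvPolynomial (σ ⊕ τ) ℝ) (A : τ → MvPolynomial σ ℝ)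
    (h : σ → MvPolynomial τ ℝ) : σ ⊕ τ → MvPolynomial (σ ⊕ τ) ℝ :=
  Sum.elim (fun i => F i + bind₁ (fun k => X (Sum.inr k) + rename Sum.inl (A k)) (h i))
    (fun k => X (Sum.inr k) + rename Sum.inl (A k))

theorem eval_rename_inl (p : MvPolynomial σ ℝ) (x : σ ⊕ τ → ℝ) :
    eval x (rename Sum.inl p) = eval (fun i => x (Sum.inl i)) p := by
  rw [eval_rename]; rfl

theorem det_jacobian_shear [Fintype σ] [DecidableEq σ] [Fintype τ] [DecidableEq τ]
    (F : σ → MvPolynomial (σ ⊕ τ) ℝ) (A : τ → MvPolynomial σ ℝ)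
    (h : σ → MvPolynomial τ ℝ) (x : σ ⊕ τ → ℝ) :
    Matrix.det (Matrix.of fun i j => eval x (pderiv j (shear F A h i))) =
      Matrix.det (Matrix.of fun i j => eval x (pderiv (Sum.inl j) (F i)) -
        ∑ k, eval x (pderiv (Sum.inr k) (F i)) *
          eval (fun i => x (Sum.inl i)) (pderiv j (A k))) := by
  set w : τ → MvPolynomial (σ ⊕ τ) ℝ := fun k => X (Sum.inr k) + rename Sum.inl (A k) with hw
  have hw_inl (k : τ) (j : σ) : eval x (pderiv (Sum.inl j) (w k)) =
      eval (fun i => x (Sum.inl i)) (pderiv j (A k)) := by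
    simp [hw, pderiv_X, pderiv_rename Sum.inl_injective, eval_rename_inl]
  have hw_inr (k l : τ) : eval x (pderiv (Sum.inr l) (w k)) = if k = l then 1 else 0 := by
    simp only [hw, map_add, pderiv_rename_inl_inr, pderiv_X, Pi.single_apply]
    split_ifs <;> simp_all
  let K : Matrix σ τ ℝ := Matrix.of fun i k => eval x (bind₁ w (pderiv k (h i)))
  let A' : Matrix τ σ ℝ := Matrix.of fun k j => eval (fun i => x (Sum.inl i)) (pderiv j (A k))
  let Fx : Matrix σ σ ℝ := Matrix.of fun i j => eval x (pderiv (Sum.inl j) (F i))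
  let Fy : Matrix σ τ ℝ := Matrix.of fun i k => eval x (pderiv (Sum.inr k) (F i))
  have hblocks : (Matrix.of fun i j => eval x (pderiv j (shear F A h i))) =
      Matrix.fromBlocks (Fx + K * A') (Fy + K) A' 1 := by
    ext (i | k) (j | l)
    · simp [shear, eval_pderiv_bind₁, Fx, K, A', Matrix.mul_apply, ← hw, hw_inl]
    · simp [shear, eval_pderiv_bind₁, Fy, K, ← hw, hw_inr]
    · exact hw_inl k j
    · exact hw_inr k l
  rw [hblocks, Matrix.det_fromBlocks_one₂₂]
  congr 1
  rw [Matrix.add_mul, add_sub_add_right_eq_sub]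
  ext i j
  simp [Fx, Fy, A', Matrix.mul_apply]

theorem homogeneousComponent_eq_sum_X_mul [Fintype σ] (p : MvPolynomial σ ℝ) (d : ℕ) :
    homogeneousComponent (d + 1) p =
      ∑ j, X j * (C ((d + 1 : ℝ)⁻¹) * pderiv j (homogeneousComponent (d + 1) p)) := by
  have h := (homogeneousComponent_isHomogeneous (d + 1) p).sum_X_mul_pderiv
  simp_rw [mul_left_comm (X _) (C _), ← Finset.mul_sum]
  rw [h, nsmul_eq_mul, ← mul_assoc, ← C_eq_coe_nat, ← C_mul]
  have : ((d : ℝ) + 1) ≠ 0 := by positivity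
  push_cast
  rw [inv_mul_cancel₀ this, C_1, one_mul]

theorem eq_sum_homogeneousComponent_of_totalDegree_le {p : MvPolynomial σ ℝ} {D : ℕ}
    (hp : p.totalDegree ≤ D) :
    p = ∑ d ∈ Finset.range (D + 1), homogeneousComponent d p := by
  conv_lhs => rw [← sum_homogeneousComponent p]
  refine Finset.sum_subset (Finset.range_mono (by omega)) fun d _ hd => ?_
  exact homogeneousComponent_eq_zero _ _ (by simpa using hd)

theorem exists_eq_C_add_sum_X_mul [Fintype σ] (D : ℕ) (p : MvPolynomial σ ℝ)
    (hp : p.totalDegree ≤ D + 1) :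
    ∃ (c : ℝ) (B : σ → MvPolynomial σ ℝ), (∀ j, (B j).totalDegree ≤ D) ∧
      p = C c + ∑ j, X j * B j := by
  refine ⟨coeff 0 p, fun j => ∑ d ∈ Finset.range (D + 1),
    C ((d + 1 : ℝ)⁻¹) * pderiv j (homogeneousComponent (d + 1) p), fun j => ?_, ?_⟩
  · refine totalDegree_finsetSum_le fun d hd => ?_
    have h := ((homogeneousComponent_isHomogeneous (d + 1) p).pderiv (i := j)).C_mul
      ((d + 1 : ℝ)⁻¹)
    exact h.totalDegree_le.trans (by simp at hd; omega)
  · conv_lhs => rw [eq_sum_homogeneousComponent_of_totalDegree_le hp, Finset.sum_range_succ',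
      homogeneousComponent_zero, add_comm]
    simp_rw [Finset.mul_sum]
    rw [Finset.sum_comm]
    congr 1
    exact Finset.sum_congr rfl fun d _ => homogeneousComponent_eq_sum_X_mul p d

theorem exists_eq_add_sum_X_mul_X_mul [Fintype σ] (D : ℕ) (p : MvPolynomial σ ℝ)
    (hp : p.totalDegree ≤ D + 2) :
    ∃ (R : MvPolynomial σ ℝ) (B : σ × σ → MvPolynomial σ ℝ), R.totalDegree ≤ 1 ∧
      (∀ j, (B j).totalDegree ≤ D) ∧ p = R + ∑ j, X j.1 * X j.2 * B j := by
  obtain ⟨c, B, hB, hpB⟩ := exists_eq_C_add_sum_X_mul (D + 1) p hp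
  choose c' B' hB' hBB' using fun j => exists_eq_C_add_sum_X_mul D (B j) (hB j)
  refine ⟨C c + ∑ j, X j * C (c' j), fun j => B' j.1 j.2, ?_, fun j => hB' _ _, ?_⟩
  · refine (totalDegree_add _ _).trans (max_le (by simp) (totalDegree_finsetSum_le fun j _ => ?_))
    exact (totalDegree_mul _ _).trans (by simp)
  · rw [hpB, Fintype.sum_prod_type, add_assoc, ← Finset.sum_add_distrib]
    congr 1
    refine Finset.sum_congr rfl fun j _ => ?_
    conv_lhs => rw [hBB' j]
    simp [mul_add, Finset.mul_sum, mul_assoc]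

/-- Every polynomial endomorphism of `ℝ^σ` satisfying `S` whose Jacobian determinant is a nonzero
constant is injective. -/
def KellerInjective (σ : Type) [Fintype σ] [DecidableEq σ]
    (S : (σ → MvPolynomial σ ℝ) → Prop) : Prop :=
  ∀ P : σ → MvPolynomial σ ℝ, S P → ∀ c : ℝ, c ≠ 0 →
    (∀ x : σ → ℝ, Matrix.det (Matrix.of fun i j => eval x (pderiv j (P i))) = c) →
    Function.Injective fun x : σ → ℝ => fun i => eval x (P i)

/-- Each component is the corresponding variable plus a cubic form. -/
def IsCubicHomogeneousForm (P : σ → MvPolynomial σ ℝ) : Prop :=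
  ∃ H : σ → MvPolynomial σ ℝ, (∀ i, (H i).IsHomogeneous 3) ∧ ∀ i, P i = X i + H i

theorem eval_bind₁ (w : τ → MvPolynomial σ ℝ) (h : MvPolynomial τ ℝ) (x : σ → ℝ) :
    eval x (bind₁ w h) = eval (fun k => eval x (w k)) h := by
  induction h using MvPolynomial.induction_on with
  | C a => simp
  | add p q hp hq => simp [hp, hq]
  | mul_X p i hp => simp [hp]

theorem eval_shear_inl (F : σ → MvPolynomial (σ ⊕ τ) ℝ) (A : τ → MvPolynomial σ ℝ)
    (h : σ → MvPolynomial τ ℝ) (x : σ ⊕ τ → ℝ) (i : σ) :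
    eval x (shear F A h (Sum.inl i)) = eval x (F i) +
      eval (fun k => eval x (shear F A h (Sum.inr k))) (h i) := by
  simp only [shear, Sum.elim_inl, Sum.elim_inr, map_add]
  rw [eval_bind₁]
  simp only [map_add]

theorem KellerInjective.of_totalDegree_step (D : ℕ) [Fintype σ] [DecidableEq σ]
    (H : KellerInjective (σ ⊕ ((σ × σ) ⊕ (σ × (σ × σ)))) fun P => ∀ i, (P i).totalDegree ≤ D + 3) :
    KellerInjective σ fun P => ∀ i, (P i).totalDegree ≤ D + 4 := by
  intro P hP c hc hdet
  choose R B hR hB hPB using fun i => exists_eq_add_sum_X_mul_X_mul (D + 2) (P i) (hP i)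
  let A : (σ × σ) ⊕ (σ × (σ × σ)) → MvPolynomial σ ℝ :=
    Sum.elim (fun j => X j.1 * X j.2) (fun k => B k.1 k.2)
  let h : σ → MvPolynomial ((σ × σ) ⊕ (σ × (σ × σ))) ℝ := fun i =>
    -∑ j, X (Sum.inl j) * X (Sum.inr (i, j))
  let F : σ → MvPolynomial (σ ⊕ ((σ × σ) ⊕ (σ × (σ × σ)))) ℝ := fun i => rename Sum.inl (P i)
  have hinj := H (shear F A h) ?_ c hc ?_
  · intro a b hab
    have := @hinj (Sum.elim a fun k => -eval a (A k)) (Sum.elim b fun k => -eval b (A k)) ?_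
    · exact funext fun i => congrFun this (Sum.inl i)
    · have hw (a : σ → ℝ) (k) : eval (Sum.elim a fun k => -eval a (A k))
          (shear F A h (Sum.inr k)) = 0 := by
        simp [shear, eval_rename_inl]
      funext i
      rcases i with i | k
      · simp only [eval_shear_inl, hw]
        simpa [F, eval_rename_inl] using congrFun hab i
      · simp only [hw]
  · have hdeg_ren (p : MvPolynomial σ ℝ) (d : ℕ) (hp : p.totalDegree ≤ d) :
        (rename (Sum.inl : σ → σ ⊕ ((σ × σ) ⊕ (σ × (σ × σ)))) p).totalDegree ≤ d :=
      (totalDegree_rename_le _ _).trans hp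
    rintro (i | k | k)
    · have : shear F A h (Sum.inl i) = rename Sum.inl (R i) - ∑ j : σ × σ,
          ((X (Sum.inr (Sum.inl j)) + X (Sum.inl j.1) * X (Sum.inl j.2)) *
              X (Sum.inr (Sum.inr (i, j))) +
            X (Sum.inr (Sum.inl j)) * rename Sum.inl (B i j)) := by
        simp only [shear, Sum.elim_inl, F, h, A]
        conv_lhs => rw [hPB i]
        simp only [map_add, map_neg, map_sum, map_mul, bind₁_X_right, rename_X, Sum.elim_inl,
          Sum.elim_inr]
        rw [add_assoc, ← sub_eq_add_neg, sub_eq_add_neg (rename _ _), ← Finset.sum_sub_distrib,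
          ← Finset.sum_neg_distrib]
        congr 1
        exact Finset.sum_congr rfl fun j _ => by ring
      rw [this]
      refine (totalDegree_sub _ _).trans (max_le (hdeg_ren _ _ ((hR i).trans (by omega))) ?_)
      refine totalDegree_finsetSum_le fun j _ => ?_
      refine (totalDegree_add _ _).trans (max_le ?_ ?_)
      · refine (totalDegree_mul _ _).trans ?_
        have h1 : (X (Sum.inr (Sum.inl j)) + X (Sum.inl j.1) * X (Sum.inl j.2) :
            MvPolynomial (σ ⊕ ((σ × σ) ⊕ (σ × (σ × σ)))) ℝ).totalDegree ≤ 2 :=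
          (totalDegree_add _ _).trans (max_le (by simp) ((totalDegree_mul _ _).trans (by simp)))
        rw [totalDegree_X]; omega
      · refine (totalDegree_mul _ _).trans ?_
        have h1 := hdeg_ren _ _ (hB i j)
        rw [totalDegree_X]; omega
    · refine (totalDegree_add _ _).trans (max_le (by simp) (hdeg_ren _ _ ?_))
      exact (totalDegree_mul _ _).trans (by simp)
    · refine (totalDegree_add _ _).trans (max_le (by simp) (hdeg_ren _ _ ?_))
      exact (hB _ _).trans (by omega)
  · intro x
    rw [det_jacobian_shear, ← hdet fun i => x (Sum.inl i)]
    simp [F, pderiv_rename_inl_inr, pderiv_rename Sum.inl_injective, eval_rename_inl]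

theorem eval_pderiv_homogeneousComponent_one (p : MvPolynomial σ ℝ) (x : σ → ℝ) (j : σ) :
    eval x (pderiv j (homogeneousComponent 1 p)) = eval 0 (pderiv j p) := by
  have h1 (y : σ → ℝ) := eval_smul_of_isHomogeneous
    ((homogeneousComponent_isHomogeneous 1 p).pderiv (i := j)) 0 y
  have h2 (d : ℕ) : eval 0 (pderiv j (homogeneousComponent (d + 1 + 1) p)) = 0 := by
    simpa using eval_smul_of_isHomogeneous
      ((homogeneousComponent_isHomogeneous (d + 1 + 1) p).pderiv (i := j)) 0 0
  conv_rhs => rw [eq_sum_homogeneousComponent_of_totalDegree_le (p.totalDegree.le_succ),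
    Finset.sum_range_succ', Finset.sum_range_succ']
  simp only [map_add, map_sum, h2, Finset.sum_const_zero, zero_add]
  simpa using (h1 x).symm

theorem eval_eq_of_totalDegree_le_three [Fintype σ] {p : MvPolynomial σ ℝ}
    (hp : p.totalDegree ≤ 3) (x : σ → ℝ) :
    eval x p = eval 0 p + ∑ j, eval 0 (pderiv j p) * x j +
      eval x (homogeneousComponent 2 p) + eval x (homogeneousComponent 3 p) := by
  have h1 : eval x (homogeneousComponent 1 p) = ∑ j, eval 0 (pderiv j p) * x j := by
    have h := (homogeneousComponent_isHomogeneous 1 p).sum_X_mul_pderiv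
    rw [one_smul] at h
    conv_lhs => rw [← h]
    simp [eval_pderiv_homogeneousComponent_one, mul_comm]
  conv_lhs => rw [eq_sum_homogeneousComponent_of_totalDegree_le hp]
  simp [Finset.sum_range_succ, h1, constantCoeff_eq]

theorem eval_smul_pderiv_of_totalDegree_le_three {p : MvPolynomial σ ℝ}
    (hp : p.totalDegree ≤ 3) (t : ℝ) (x : σ → ℝ) (j : σ) :
    eval (t • x) (pderiv j p) = eval 0 (pderiv j p) +
      t * eval x (pderiv j (homogeneousComponent 2 p)) +
      t ^ 2 * eval x (pderiv j (homogeneousComponent 3 p)) := by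
  have h (d : ℕ) := eval_smul_of_isHomogeneous
    ((homogeneousComponent_isHomogeneous d p).pderiv (i := j)) t x
  conv_lhs => rw [eq_sum_homogeneousComponent_of_totalDegree_le hp]
  simp [Finset.sum_range_succ, h, eval_pderiv_homogeneousComponent_one]

theorem KellerInjective.of_isCubicHomogeneousForm [Fintype σ] [DecidableEq σ]
    (H : KellerInjective (σ ⊕ (σ ⊕ Unit)) IsCubicHomogeneousForm) :
    KellerInjective σ fun P => ∀ i, (P i).totalDegree ≤ 3 := by
  intro P hP c hc hdet
  let M : Matrix σ σ ℝ := Matrix.of fun i j => eval 0 (pderiv j (P i))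
  have hM : IsUnit M.det := by
    rw [isUnit_iff_ne_zero, hdet 0]
    exact hc
  let Q : σ → MvPolynomial σ ℝ := fun i => ∑ k, C (M⁻¹ i k) * homogeneousComponent 2 (P k)
  let K : σ → MvPolynomial σ ℝ := fun i => ∑ k, C (M⁻¹ i k) * homogeneousComponent 3 (P k)
  have hQ (i) : (Q i).IsHomogeneous 2 :=
    .sum _ _ _ fun k _ => (homogeneousComponent_isHomogeneous 2 (P k)).C_mul _
  have hK (i) : (K i).IsHomogeneous 3 :=
    .sum _ _ _ fun k _ => (homogeneousComponent_isHomogeneous 3 (P k)).C_mul _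
  let t : MvPolynomial (σ ⊕ (σ ⊕ Unit)) ℝ := X (Sum.inr (Sum.inr ()))
  let F : σ → MvPolynomial (σ ⊕ (σ ⊕ Unit)) ℝ := fun i =>
    X (Sum.inl i) + t * rename Sum.inl (Q i) + t ^ 2 * rename Sum.inl (K i)
  let A : σ ⊕ Unit → MvPolynomial σ ℝ := Sum.elim (fun i => -K i) fun _ => 0
  let h : σ → MvPolynomial (σ ⊕ Unit) ℝ := fun i => X (Sum.inr ()) ^ 2 * X (Sum.inl i)
  have hinv (v : σ → ℝ) (i : σ) : ∑ k, M⁻¹ i k * ∑ j, M k j * v j = v i := by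
    have : M⁻¹.mulVec (M.mulVec v) = v := by
      rw [Matrix.mulVec_mulVec, Matrix.nonsing_inv_mul M hM, Matrix.one_mulVec]
    exact congrFun this i
  have hcubic : IsCubicHomogeneousForm (shear F A h) := by
    refine ⟨Sum.elim (fun i => t * rename Sum.inl (Q i) + t ^ 2 * X (Sum.inr (Sum.inl i)))
      (Sum.elim (fun i => -rename Sum.inl (K i)) fun _ => 0), ?_, ?_⟩
    · have ht : t.IsHomogeneous 1 := isHomogeneous_X _ _
      rintro (i | i | i)
      · exact (ht.mul (hQ i).rename_isHomogeneous).add ((ht.pow 2).mul (isHomogeneous_X _ _))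
      · exact (hK i).rename_isHomogeneous.neg
      · exact isHomogeneous_zero _ _ _
    · rintro (i | i | i)
      · simp [shear, F, A, h, t]
        ring
      · simp [shear, A]
      · simp [shear, A]
  have hinj := H (shear F A h) hcubic (M⁻¹.det * c)
    (mul_ne_zero (Matrix.isUnit_nonsing_inv_det M hM).ne_zero hc) ?_
  · intro a b hab
    let lift (a : σ → ℝ) : σ ⊕ (σ ⊕ Unit) → ℝ := Sum.elim a (Sum.elim (fun i => eval a (K i)) 1)
    have hF (a : σ → ℝ) (i : σ) : eval (lift a) (F i) =
        ∑ k, M⁻¹ i k * (eval a (P k) - eval 0 (P k)) := by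
      have h1 (k : σ) : eval a (P k) - eval 0 (P k) = ∑ j, M k j * a j +
          eval a (homogeneousComponent 2 (P k)) + eval a (homogeneousComponent 3 (P k)) := by
        rw [eval_eq_of_totalDegree_le_three (hP k) a]
        simp only [M, Matrix.of_apply]
        ring
      simp_rw [h1, mul_add, Finset.sum_add_distrib, hinv]
      simp [F, t, lift, eval_rename_inl, Q, K]
    have hw (a : σ → ℝ) (k) : eval (lift a) (shear F A h (Sum.inr k)) =
        Sum.elim (fun _ => 0) 1 k := by
      rcases k with k | k <;> simp [shear, eval_rename_inl, A, lift]
    refine funext fun i => congrFun (@hinj (lift a) (lift b) ?_) (Sum.inl i)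
    funext i
    rcases i with i | k
    · simp only [eval_shear_inl, hw, hF]
      simp only [fun k => congrFun hab k]
    · simp only [hw]
  · intro x
    rw [det_jacobian_shear, ← hdet (x (Sum.inr (Sum.inr ())) • fun i => x (Sum.inl i)),
      ← Matrix.det_mul]
    congr 1
    ext i j
    have hδ : ∑ k, M⁻¹ i k * eval 0 (pderiv j (P k)) = if i = j then 1 else 0 := by
      have := congrFun (congrFun (Matrix.nonsing_inv_mul M hM) i) j
      simpa [Matrix.mul_apply, Matrix.one_apply, M] using this
    simp only [Matrix.of_apply, Matrix.mul_apply,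
      fun k => eval_smul_pderiv_of_totalDegree_le_three (hP k), mul_add, Finset.sum_add_distrib, hδ]
    simp [F, t, A, Q, K, pderiv_rename_inl_inr, pderiv_rename Sum.inl_injective, eval_rename_inl,
      pderiv_X, Pi.single_apply, Finset.mul_sum, mul_left_comm]

theorem KellerInjective.of_equiv {ι : Type} [Fintype σ] [DecidableEq σ] [Fintype ι]
    [DecidableEq ι] (e : σ ≃ ι) (H : KellerInjective ι IsCubicHomogeneousForm) :
    KellerInjective σ IsCubicHomogeneousForm := by
  rintro P ⟨K, hK, hPK⟩ c hc hdet a b hab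
  have heval (p : MvPolynomial σ ℝ) (x : ι → ℝ) : eval x (rename e p) = eval (x ∘ e) p :=
    eval_rename _ _ _
  have hinj := H (fun i => rename e (P (e.symm i)))
    ⟨fun i => rename e (K (e.symm i)), fun i => (hK _).rename_isHomogeneous,
      fun i => by simp [hPK]⟩ c hc ?_
  · have := @hinj (a ∘ e.symm) (b ∘ e.symm) ?_
    · funext i
      simpa using congrFun this (e i)
    · funext i
      simpa [heval, Function.comp_assoc] using congrFun hab (e.symm i)
  · intro x
    rw [← hdet (x ∘ e), ← Matrix.det_reindex_self e]
    congr 1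
    ext i j
    have := pderiv_rename e.injective (e.symm j) (P (e.symm i))
    rw [e.apply_symm_apply] at this
    simp [this, heval]

theorem KellerInjective.of_totalDegree_le
    (H : ∀ (σ : Type) [Fintype σ] [DecidableEq σ], 2 ≤ Fintype.card σ →
      KellerInjective σ IsCubicHomogeneousForm) (D : ℕ) :
    ∀ (σ : Type) [Fintype σ] [DecidableEq σ], 2 ≤ Fintype.card σ →
      KellerInjective σ fun P => ∀ i, (P i).totalDegree ≤ D + 3 := by
  induction D with
  | zero =>
    intro σ _ _ hσ
    exact .of_isCubicHomogeneousForm (H _ (by rw [Fintype.card_sum]; omega))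
  | succ D ih =>
    intro σ _ _ hσ
    exact .of_totalDegree_step D (ih _ (by rw [Fintype.card_sum]; omega))

end



/-- If for every n ≥ 2 every polynomial mapping of cubic homogeneous form
F = I + H (each Hᵢ zero or homogeneous of degree 3) with nonzero constant Jacobian
determinant is injective, then for every n ≥ 2 every polynomial mapping ℝⁿ → ℝⁿ with
nonzero constant Jacobian determinant is injective. -/
theorem stmt_11
    (hcubic : ∀ n : ℕ, 2 ≤ n → ∀ H : Fin n → MvPolynomial (Fin n) ℝ,
      (∀ i, H i = 0 ∨ (H i).IsHomogeneous 3) →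
      ∀ c : ℝ, c ≠ 0 →
      (∀ x : Fin n → ℝ,
        Matrix.det (Matrix.of fun i j => eval x (pderiv j (X i + H i))) = c) →
      Function.Injective (fun x : Fin n → ℝ => fun i => eval x (X i + H i))) :
    ∀ n : ℕ, 2 ≤ n → ∀ P : Fin n → MvPolynomial (Fin n) ℝ, ∀ c : ℝ, c ≠ 0 →
      (∀ x : Fin n → ℝ,
        Matrix.det (Matrix.of fun i j => eval x (pderiv j (P i))) = c) →
      Function.Injective (fun x : Fin n → ℝ => fun i => eval x (P i)) := by
  intro n hn P c hc hdet
  refine KellerInjective.of_totalDegree_le (fun σ _ _ hσ => ?_)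
    (Finset.univ.sup fun i => (P i).totalDegree) (Fin n) (by simpa using hn) P (fun i => ?_) c hc
    hdet
  · refine .of_equiv (Fintype.equivFin σ) ?_
    rintro F ⟨H, hH, hFH⟩ c hc hdet
    obtain rfl : F = fun i => X i + H i := funext hFH
    exact hcubic _ hσ H (fun i => Or.inr (hH i)) c hc hdet
  · exact (Finset.le_sup (f := fun i => (P i).totalDegree) (Finset.mem_univ i)).trans
      (Nat.le_add_right _ _)
end
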